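/- Convergence of Bott–Taubes configuration space integrals: for every knot K, every degree-n trivalent diagram D with a labeling of its vertices and an ordering of its edges, the configuration space integral I(D,K) converges absolutely, i.e., the integrand defining I(D,K) is Lebesgue integrable on the open domain C(D,K). -/

import Mathlib

open scoped Classical

/-- A labeled trivalent-diagram datum of degree `n`: the `2n` vertices are `Fin (2*n)`,
`k` of them are interval vertices, listed in their interval order by `iv`, and `edges`
is the multiset of chords/edges (unordered pairs of distinct vertices). -/
structure Diagram (n : ℕ) where
  k : ℕ
  iv : Fin k → Fin (2 * n)
  edges : Multiset (Sym2 (Fin (2 * n)))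

namespace Diagram

variable {n : ℕ}

/-- `v` is an interval vertex of `D`. -/
def IsIntervalVertex (D : Diagram n) (v : Fin (2 * n)) : Prop :=
  ∃ i, D.iv i = v

/-- The number of edges of `D` containing the vertex `v` (with multiplicity). -/
noncomputable def degree (D : Diagram n) (v : Fin (2 * n)) : ℕ :=
  Multiset.card (D.edges.filter fun e => v ∈ e)

/-- Adjacency: an edge of `D`, or a pair of consecutive interval vertices. -/
def adj (D : Diagram n) (v w : Fin (2 * n)) : Prop :=
  s(v, w) ∈ D.edges ∨
    ∃ i j : Fin D.k, (j : ℕ) = (i : ℕ) + 1 ∧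
      ((D.iv i = v ∧ D.iv j = w) ∨ (D.iv i = w ∧ D.iv j = v))

/-- `D` is a trivalent diagram: interval vertices have exactly one incident edge,
free vertices exactly three, there are no loops, and the diagram (with the interval
added) is connected. -/
structure IsTrivalent (D : Diagram n) : Prop where
  k_le : D.k ≤ 2 * n
  iv_inj : Function.Injective D.iv
  not_diag : ∀ e ∈ D.edges, ¬ e.IsDiag
  degree_interval : ∀ v, D.IsIntervalVertex v → D.degree v = 1
  degree_free : ∀ v, ¬ D.IsIntervalVertex v → D.degree v = 3
  connected : ∀ v w, Relation.ReflTransGen D.adj v w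

/-- Isomorphism of labeled diagrams: a bijection of the vertices preserving the
edge multiset, the interval/free partition and the linear order of interval vertices. -/
def Iso (D₁ D₂ : Diagram n) : Prop :=
  ∃ σ : Fin (2 * n) ≃ Fin (2 * n),
    D₁.edges.map (Sym2.map σ) = D₂.edges ∧
    ∃ h : D₁.k = D₂.k, ∀ i : Fin D₁.k, σ (D₁.iv i) = D₂.iv (Fin.cast h i)

/-- The STU relation: `S` has a free vertex `w` joined by an edge to an interval vertex
`v` (at interval position `p`) and by its two other edges to ends `a` and `b`; `T`
(resp. `U`) is obtained by deleting the edge `v w` and making `v, w` consecutive interval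
vertices carrying `a` then `b` (resp. `b` then `a`) along the interval. -/
def STU (S T U : Diagram n) : Prop :=
  ∃ (v w a b : Fin (2 * n)) (p : Fin S.k) (rest : Multiset (Sym2 (Fin (2 * n)))),
    S.iv p = v ∧ ¬ S.IsIntervalVertex w ∧
    S.edges = s(v, w) ::ₘ s(w, a) ::ₘ s(w, b) ::ₘ rest ∧
    T.k = S.k + 1 ∧ U.k = S.k + 1 ∧
    T.edges = s(v, a) ::ₘ s(w, b) ::ₘ rest ∧
    U.edges = s(v, b) ::ₘ s(w, a) ::ₘ rest ∧
    (∀ (i : Fin T.k) (h : (i : ℕ) < S.k), (i : ℕ) ≤ (p : ℕ) → T.iv i = S.iv ⟨i, h⟩) ∧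
    (∀ i : Fin T.k, (i : ℕ) = (p : ℕ) + 1 → T.iv i = w) ∧
    (∀ (i : Fin T.k) (h : (i : ℕ) - 1 < S.k), (p : ℕ) + 1 < (i : ℕ) →
      T.iv i = S.iv ⟨(i : ℕ) - 1, h⟩) ∧
    (∀ (i : Fin U.k) (j : Fin T.k), (i : ℕ) = (j : ℕ) → U.iv i = T.iv j)

end Diagram

/-- The type of trivalent diagrams of degree `n`. -/
abbrev TD (n : ℕ) := {D : Diagram n // D.IsTrivalent}

/-- The free real vector space on trivalent diagrams of degree `n`. -/
abbrev FreeTD (n : ℕ) := TD n →₀ ℝ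

/-- The STU relators, together with the identifications of isomorphic diagrams. -/
def stuRelations (n : ℕ) : Set (FreeTD n) :=
  {x | ∃ S T U : TD n, Diagram.STU S.1 T.1 U.1 ∧
        x = Finsupp.single S 1 - Finsupp.single T 1 + Finsupp.single U 1} ∪
  {x | ∃ D₁ D₂ : TD n, Diagram.Iso D₁.1 D₂.1 ∧
        x = Finsupp.single D₁ 1 - Finsupp.single D₂ 1}

/-- `𝒟ₙ`: the real vector space generated by degree-`n` trivalent diagrams modulo STU. -/
abbrev Dspace (n : ℕ) := FreeTD n ⧸ Submodule.span ℝ (stuRelations n)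

/-- The class of a trivalent diagram in `𝒟ₙ`. -/
noncomputable def toD {n : ℕ} (D : TD n) : Dspace n :=
  Submodule.Quotient.mk (Finsupp.single D 1)

/-- `ℝ³` with its Euclidean norm. -/
abbrev E3 := EuclideanSpace ℝ (Fin 3)

/-- The determinant of the 3×3 matrix with columns `u`, `v`, `w`. -/
def det3 (u v w : E3) : ℝ :=
  u 0 * (v 1 * w 2 - v 2 * w 1) - u 1 * (v 0 * w 2 - v 2 * w 0) +
    u 2 * (v 0 * w 1 - v 1 * w 0)

/-- The cross product on `ℝ³`. -/
noncomputable def cross3 (u v : E3) : E3 :=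
  EuclideanSpace.single 0 (u 1 * v 2 - u 2 * v 1) +
  EuclideanSpace.single 1 (u 2 * v 0 - u 0 * v 2) +
  EuclideanSpace.single 2 (u 0 * v 1 - u 1 * v 0)

/-- A knot: a smooth `1`-periodic map `ℝ → ℝ³` with nowhere-vanishing derivative whose
restriction to `[0,1)` is injective. -/
structure IsKnot (K : ℝ → E3) : Prop where
  smooth : ContDiff ℝ (⊤ : ℕ∞) K
  periodic : Function.Periodic K 1
  injOn : Set.InjOn K (Set.Ico (0 : ℝ) 1)
  deriv_ne : ∀ t, deriv K t ≠ 0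

/-- A smooth isotopy between two knots. -/
def KnotIsotopic (K₀ K₁ : ℝ → E3) : Prop :=
  ∃ H : ℝ → ℝ → E3,
    ContDiff ℝ (⊤ : ℕ∞) (fun p : ℝ × ℝ => H p.1 p.2) ∧
    (∀ t ∈ Set.Icc (0 : ℝ) 1, IsKnot (H t)) ∧
    H 0 = K₀ ∧ H 1 = K₁

/-- A knot invariant: a real-valued function taking equal values on smoothly isotopic
knots. -/
def IsKnotInvariant (V : (ℝ → E3) → ℝ) : Prop :=
  ∀ K₀ K₁ : ℝ → E3, IsKnot K₀ → IsKnot K₁ → KnotIsotopic K₀ K₁ → V K₀ = V K₁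

/-- The normalized area `2`-form of `S²` (extended to ambient `ℝ³`):
`ω_u(a, b) = det(u, a, b) / 4π`. -/
noncomputable def sphereForm (u a b : E3) : ℝ := det3 u a b / (4 * Real.pi)

open scoped BigOperators Topology

namespace Diagram

variable {n : ℕ}

/-- The interval vertices of `D`. -/
abbrev IntV (D : Diagram n) := {v : Fin (2 * n) // D.IsIntervalVertex v}

/-- The free vertices of `D`. -/
abbrev FreeV (D : Diagram n) := {v : Fin (2 * n) // ¬ D.IsIntervalVertex v}

/-- The configuration space `ℝᵏ × (ℝ³)ˢ` of the diagram `D`: a time in `(0,1)` for each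
interval vertex and a point of `ℝ³` for each free vertex. -/
abbrev Config (D : Diagram n) := (D.IntV → ℝ) × (D.FreeV → E3)

/-- The point `Pᵢ` of `ℝ³` associated to the vertex `i`: `K(xᵢ)` for an interval vertex,
`yᵢ` for a free vertex. -/
noncomputable def pt (D : Diagram n) (K : ℝ → E3) (z : D.Config) (i : Fin (2 * n)) : E3 :=
  if h : D.IsIntervalVertex i then K (z.1 ⟨i, h⟩) else z.2 ⟨i, h⟩

end Diagram

/-- The smaller endpoint of an edge. -/
noncomputable def emin {α : Type*} [LinearOrder α] (e : Sym2 α) : α :=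
  Sym2.lift ⟨fun a b => a ⊓ b, fun a b => inf_comm a b⟩ e

/-- The larger endpoint of an edge. -/
noncomputable def emax {α : Type*} [LinearOrder α] (e : Sym2 α) : α :=
  Sym2.lift ⟨fun a b => a ⊔ b, fun a b => sup_comm a b⟩ e

namespace Diagram

variable {n : ℕ}

/-- The Gauss direction map `h_e = (P_j − P_i)/‖P_j − P_i‖` of the edge `e = {i, j}`,
`i < j`. -/
noncomputable def edgeDir (D : Diagram n) (K : ℝ → E3) (e : Sym2 (Fin (2 * n)))
    (z : D.Config) : E3 :=
  ‖pt D K z (emax e) - pt D K z (emin e)‖⁻¹ • (pt D K z (emax e) - pt D K z (emin e))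

/-- The pullback `h_e^*ω` of the normalized area form of `S²` under the Gauss map of the
edge `e`, as a `2`-form on the configuration space at the point `z`. -/
noncomputable def edgeForm (D : Diagram n) (K : ℝ → E3) (e : Sym2 (Fin (2 * n)))
    (z V W : D.Config) : ℝ :=
  sphereForm (D.edgeDir K e z)
    (fderiv ℝ (D.edgeDir K e) z V) (fderiv ℝ (D.edgeDir K e) z W)

/-- The index set of the standard basis of `ℝᵏ × (ℝ³)ˢ`. -/
abbrev BasisIndex (D : Diagram n) := D.IntV ⊕ (D.FreeV × Fin 3)

/-- The standard basis vectors of `ℝᵏ × (ℝ³)ˢ`. -/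
noncomputable def basisVec (D : Diagram n) : D.BasisIndex → D.Config
  | Sum.inl i => (Pi.single i 1, 0)
  | Sum.inr (v, j) => (0, Pi.single v (EuclideanSpace.single j 1))

end Diagram

/-- Evaluation of the wedge `α₁ ∧ ⋯ ∧ α_m` of `m` (alternating) `2`-forms on a
`2m`-tuple of vectors. -/
noncomputable def wedgeEval {V : Type*} (m : ℕ) (α : Fin m → V → V → ℝ)
    (v : Fin (2 * m) → V) : ℝ :=
  (∑ σ : Equiv.Perm (Fin (2 * m)), ((Equiv.Perm.sign σ : ℤ) : ℝ) *
      ∏ t : Fin m,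
        α t (v (σ ⟨2 * (t : ℕ), by have := t.isLt; omega⟩))
            (v (σ ⟨2 * (t : ℕ) + 1, by have := t.isLt; omega⟩))) / 2 ^ m

namespace Diagram

variable {n : ℕ}

/-- The integrand of the configuration space integral `I(D, K)`: the pullback under
`h_D` of the wedge, in the order given by the edge list `L`, of the pullbacks of the
normalized area form of `S²` under the projections, evaluated on the standard ordered
basis of `ℝᵏ × (ℝ³)ˢ` (ordered by `ord`). -/
noncomputable def csIntegrand (D : Diagram n) (K : ℝ → E3)
    (L : List (Sym2 (Fin (2 * n)))) (ord : Fin (2 * L.length) ≃ D.BasisIndex)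
    (z : D.Config) : ℝ :=
  wedgeEval L.length (fun t => D.edgeForm K (L.get t) z)
    (fun i => D.basisVec (ord i))

/-- The domain `C(D, K)` of the configuration space integral: the times of the interval
vertices lie in `(0,1)` in the interval order, and `P_i ≠ P_j` for every edge `{i,j}`. -/
def csDomain (D : Diagram n) (K : ℝ → E3) : Set D.Config :=
  {z | (∀ i : Fin D.k, 0 < z.1 ⟨D.iv i, ⟨i, rfl⟩⟩ ∧ z.1 ⟨D.iv i, ⟨i, rfl⟩⟩ < 1) ∧
       (∀ i j : Fin D.k, (i : ℕ) < (j : ℕ) →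
          z.1 ⟨D.iv i, ⟨i, rfl⟩⟩ < z.1 ⟨D.iv j, ⟨j, rfl⟩⟩) ∧
       (∀ e ∈ D.edges, ∀ i j : Fin (2 * n), e = s(i, j) →
          D.pt K z i ≠ D.pt K z j)}

/-- The configuration space integral `I(D, K)`. -/
noncomputable def csIntegral (D : Diagram n) (K : ℝ → E3)
    (L : List (Sym2 (Fin (2 * n)))) (ord : Fin (2 * L.length) ≃ D.BasisIndex) : ℝ :=
  ∫ z in D.csDomain K, D.csIntegrand K L ord z

end Diagram

/-- `I(D₁, K)`, the Gauss self-linking integral of `K` (the integral associated to the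
one-chord diagram `D₁`). -/
noncomputable def gaussIntegral (K : ℝ → E3) : ℝ :=
  (1 / (4 * Real.pi)) *
    ∫ p in {p : ℝ × ℝ | 0 < p.1 ∧ p.1 < p.2 ∧ p.2 < 1},
      det3 (deriv K p.1) (deriv K p.2) (K p.2 - K p.1) / ‖K p.2 - K p.1‖ ^ 3

/-- A weight system of degree `n`: a function on trivalent diagrams, invariant under
isomorphism, vanishing on all STU combinations `S − T + U`. -/
def IsWeightSystem {n : ℕ} (W : Diagram n → ℝ) : Prop :=
  (∀ D₁ D₂ : Diagram n, D₁.IsTrivalent → D₂.IsTrivalent → Diagram.Iso D₁ D₂ →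
      W D₁ = W D₂) ∧
  (∀ S T U : Diagram n, S.IsTrivalent → T.IsTrivalent → U.IsTrivalent →
      Diagram.STU S T U → W S - W T + W U = 0)

namespace Diagram

/-- Inclusion of the vertices of the first summand of a connected sum. -/
def vinl (n n' : ℕ) (v : Fin (2 * n)) : Fin (2 * (n + n')) :=
  ⟨(v : ℕ), by have := v.isLt; omega⟩

/-- Inclusion of the vertices of the second summand of a connected sum. -/
def vinr (n n' : ℕ) (v : Fin (2 * n')) : Fin (2 * (n + n')) :=
  ⟨2 * n + (v : ℕ), by have := v.isLt; omega⟩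

/-- The connected sum of two diagrams: the interval of `D'` is concatenated after that
of `D`. -/
def csum {n n' : ℕ} (D : Diagram n) (D' : Diagram n') : Diagram (n + n') where
  k := D.k + D'.k
  iv := fun i =>
    if h : (i : ℕ) < D.k then vinl n n' (D.iv ⟨i, h⟩)
    else vinr n n' (D'.iv ⟨(i : ℕ) - D.k, by have := i.isLt; omega⟩)
  edges := D.edges.map (Sym2.map (vinl n n')) + D'.edges.map (Sym2.map (vinr n n'))

end Diagram

/-- A diagram is reducible if it is (isomorphic to) a connected sum of two nonempty
diagrams. -/
def IsReducible {n : ℕ} (D : Diagram n) : Prop :=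
  ∃ (n₁ n₂ : ℕ) (D₁ : Diagram n₁) (D₂ : Diagram n₂) (h : n₁ + n₂ = n),
    0 < n₁ ∧ 0 < n₂ ∧ D₁.IsTrivalent ∧ D₂.IsTrivalent ∧
      Diagram.Iso (h ▸ Diagram.csum D₁ D₂) D

/-- A primitive weight system: a weight system vanishing on all reducible diagrams. -/
def IsPrimitiveWeightSystem {n : ℕ} (W : Diagram n → ℝ) : Prop :=
  IsWeightSystem W ∧ ∀ D : Diagram n, D.IsTrivalent → IsReducible D → W D = 0

/-- The function `V(K) = Σ_D ε_D · W(D) · (I(D,K) − M_D · I(D₁,K))`, the sum ranging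
over all (labeled) degree-`n` trivalent diagrams. -/
noncomputable def csInvariant (n : ℕ) (W : Diagram n → ℝ)
    (L : ∀ D : Diagram n, List (Sym2 (Fin (2 * n))))
    (ord : ∀ (D : Diagram n), D.IsTrivalent → (Fin (2 * (L D).length) ≃ D.BasisIndex))
    (ε M : Diagram n → ℝ) (K : ℝ → E3) : ℝ :=
  ∑ᶠ (D : Diagram n) (hD : D.IsTrivalent),
    ε D * W D * (D.csIntegral K (L D) (ord D hD) - M D * gaussIntegral K)

namespace CSI

variable {V : Type*}

/-- weight `1 + |P_v|` -/
noncomputable def tt (P : V → E3) (v : V) : ℝ := 1 + ‖P v‖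

noncomputable def rnear (P : V → E3) (b : V) : List V → ℝ
  | [] => tt P b
  | v :: l => if v = b then rnear P b l else min ‖P v - P b‖ (rnear P b l)

noncomputable def phi (isK : V → Prop) (ε : ℝ) (P : V → E3) (a : V) : Option V → List V → ℝ
  | none, _ => if isK a then 1 else (tt P a) ^ (-(3 + ε))
  | some b, l => if ‖P a - P b‖ ≤ rnear P b l then
      (if isK a then (rnear P b l)⁻¹ else (‖P a - P b‖ ^ 2 * rnear P b l)⁻¹) else 0

noncomputable def FF (isK : V → Prop) (ε : ℝ) : List (V × Option V) → (V → E3) → ℝ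
  | [], _ => 1
  | (a, o) :: l, P => phi isK ε P a o (l.map Prod.fst) * FF isK ε l P

def WF : List (V × Option V) → Prop
  | [] => True
  | (a, o) :: l => a ∉ l.map Prod.fst ∧ (∀ b ∈ o, b ∈ l.map Prod.fst) ∧ WF l

noncomputable def disp (isK : V → Prop) (T : V → E3) (c : V → E3) (v : V) : E3 :=
  if isK v then c v 0 • T v else c v

def PairOK (C δ : ℝ) (P : V → E3) (W : V → E3) (lam : V → ℝ) (i l : V) : Prop :=
  (lam i = lam l ∧ ‖W i - W l - lam i • (P i - P l)‖ ≤ C * ‖P i - P l‖) ∨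
  (‖W i - W l‖ ≤ C * ‖P i - P l‖ ∧ |lam i| * δ ≤ C * ‖P i - P l‖ ∧
    |lam l| * δ ≤ C * ‖P i - P l‖)

structure GoodL (C δ τ : ℝ) (P : V → E3) (S : Finset V) (W : V → E3) (lam : V → ℝ) : Prop where
  pair : ∀ i ∈ S, ∀ l ∈ S, i ≠ l → PairOK C δ P W lam i l
  size : ∀ i ∈ S, ‖W i‖ ≤ C * tt P i ∧ |lam i| * δ ≤ C * tt P i ∧
    ((W i = 0 ∧ lam i = 0) ∨ tt P i ≤ C * τ)

lemma tt_ge_one (P : V → E3) (v : V) : 1 ≤ tt P v := by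
  unfold tt; linarith [norm_nonneg (P v)]

lemma tt_le_add (P : V → E3) (a b : V) : tt P a ≤ tt P b + ‖P a - P b‖ := by
  unfold tt
  have := norm_add_le (P b) (P a - P b)
  rw [add_sub_cancel] at this
  linarith

lemma tt_le_add' (P : V → E3) (a b : V) : tt P b ≤ tt P a + ‖P a - P b‖ := by
  have := tt_le_add P b a
  rwa [norm_sub_rev] at this

lemma PairOK.symm {C δ : ℝ} {P : V → E3} {W : V → E3} {lam : V → ℝ} {i l : V}
    (h : PairOK C δ P W lam i l) : PairOK C δ P W lam l i := by
  rcases h with ⟨h1, h2⟩ | ⟨h1, h2, h3⟩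
  · left
    refine ⟨h1.symm, ?_⟩
    rw [← h1, norm_sub_rev (P l)]
    convert h2 using 1
    rw [← norm_neg]
    congr 1
    module
  · right
    rw [norm_sub_rev (P l), norm_sub_rev (W l)]
    exact ⟨h1, h3, h2⟩

lemma GoodL.mono {C C' δ δ' τ : ℝ} {P : V → E3} {S : Finset V} {W : V → E3} {lam : V → ℝ}
    (h : GoodL C δ τ P S W lam) (hC : C ≤ C') (hδ : δ' ≤ δ) (hτ : 0 ≤ τ) :
    GoodL C' δ' τ P S W lam := by
  have key : ∀ (x y : ℝ), |x| * δ ≤ C * y → 0 ≤ y → |x| * δ' ≤ C' * y := by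
    intro x y h hy
    nlinarith [abs_nonneg x, mul_le_mul_of_nonneg_left hδ (abs_nonneg x),
      mul_le_mul_of_nonneg_right hC hy]
  have key2 : ∀ (x y : ℝ), x ≤ C * y → 0 ≤ y → x ≤ C' * y := by
    intro x y h hy
    nlinarith [mul_le_mul_of_nonneg_right hC hy]
  refine ⟨fun i hi l hl hil => ?_, fun i hi => ?_⟩
  · rcases h.pair i hi l hl hil with ⟨h1, h2⟩ | ⟨h1, h2, h3⟩
    · exact Or.inl ⟨h1, key2 _ _ h2 (norm_nonneg _)⟩
    · exact Or.inr ⟨key2 _ _ h1 (norm_nonneg _), key _ _ h2 (norm_nonneg _),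
        key _ _ h3 (norm_nonneg _)⟩
  · obtain ⟨h1, h2, h3⟩ := h.size i hi
    have ht : 0 ≤ tt P i := by linarith [tt_ge_one P i]
    refine ⟨key2 _ _ h1 ht, key _ _ h2 ht, ?_⟩
    rcases h3 with h3 | h3
    · exact Or.inl h3
    · exact Or.inr (key2 _ _ h3 hτ)

lemma PairOK.congr {C δ : ℝ} {P : V → E3} {W W' : V → E3} {lam lam' : V → ℝ} {i l : V}
    (h : PairOK C δ P W lam i l) (h1 : W' i = W i) (h2 : W' l = W l) (h3 : lam' i = lam i)
    (h4 : lam' l = lam l) : PairOK C δ P W' lam' i l := by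
  unfold PairOK at *
  rw [h1, h2, h3, h4]; exact h

/-- extension of an old row to a new vertex `a` attached to `b`. -/
lemma GoodL.extend {C D τ r : ℝ} {P : V → E3} {S : Finset V} {W W' : V → E3}
    {lam lam' : V → ℝ} (hG : GoodL C r τ P S W lam) {a b : V} (ha : a ∉ S) (hb : b ∈ S)
    (hr : r = ‖P a - P b‖) (hC : 1 ≤ C) (hD : 0 ≤ D) (hτ : 0 ≤ τ)
    (hmin : ∀ l ∈ S, r ≤ ‖P a - P l‖) (hra : r ≤ tt P a) (hrb : r ≤ tt P b)
    (hW : ∀ i ∈ S, W' i = W i) (hlam : ∀ i ∈ S, lam' i = lam i) (hlama : lam' a = lam b)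
    (hE : ‖W' a - W b - lam b • (P a - P b)‖ ≤ D * r)
    (hz : W b = 0 → lam b = 0 → W' a = 0) :
    GoodL (D + 4 * C) r τ P (insert a S) W' lam' := by
  have hG' := hG.mono (show C ≤ D + 4 * C by linarith) le_rfl hτ
  have hr0 : 0 ≤ r := hr ▸ norm_nonneg _
  have hlr : ‖lam b • (P a - P b)‖ = |lam b| * r := by rw [norm_smul, hr]; rfl
  have hWa : ‖W' a‖ ≤ D * r + |lam b| * r + ‖W b‖ := by
    have h1 : W' a = (W' a - W b - lam b • (P a - P b)) + lam b • (P a - P b) + W b := by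
      module
    calc ‖W' a‖ = ‖(W' a - W b - lam b • (P a - P b)) + lam b • (P a - P b) + W b‖ := by
          rw [← h1]
      _ ≤ _ := norm_add₃_le
      _ ≤ _ := by rw [hlr]; gcongr
  have hpa : ∀ l ∈ S, PairOK (D + 4 * C) r P W' lam' a l := by
    intro l hl
    by_cases hlb : l = b
    · subst hlb
      left
      rw [hlama, hlam l hl, hW l hl]
      refine ⟨rfl, hE.trans ?_⟩
      rw [← hr]
      nlinarith
    · have hrl := hmin l hl
      have hbl : ‖P b - P l‖ ≤ 2 * ‖P a - P l‖ := by
        have : P b - P l = (P a - P l) - (P a - P b) := by module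
        rw [this]
        refine (norm_sub_le _ _).trans ?_
        rw [← hr]; linarith
      have hCbl : C * ‖P b - P l‖ ≤ 2 * C * ‖P a - P l‖ := by nlinarith
      have hDr : D * r ≤ D * ‖P a - P l‖ := by gcongr
      rcases hG.pair b hb l hl (Ne.symm hlb) with ⟨h1, h2⟩ | ⟨h1, h2, h3⟩
      · left
        rw [hlama, hlam l hl, hW l hl]
        refine ⟨h1, ?_⟩
        have : W' a - W l - lam b • (P a - P l) = (W' a - W b - lam b • (P a - P b)) +
          (W b - W l - lam b • (P b - P l)) := by module
        rw [this]
        refine (norm_add_le _ _).trans ?_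
        nlinarith [norm_nonneg (P a - P l)]
      · right
        rw [hlama, hlam l hl, hW l hl]
        refine ⟨?_, ?_, ?_⟩
        · have : W' a - W l = (W' a - W b - lam b • (P a - P b)) + lam b • (P a - P b) +
            (W b - W l) := by module
          rw [this]
          refine norm_add₃_le.trans ?_
          rw [hlr]
          nlinarith [norm_nonneg (P a - P l)]
        · nlinarith [norm_nonneg (P a - P l)]
        · nlinarith [norm_nonneg (P a - P l)]
  have htab : tt P a ≤ 2 * tt P b := by
    have := tt_le_add P a b
    rw [← hr] at this; linarith
  have htba : tt P b ≤ 2 * tt P a := by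
    have := tt_le_add' P a b
    rw [← hr] at this; linarith
  refine ⟨fun i hi l hl hil => ?_, fun i hi => ?_⟩
  · rcases Finset.mem_insert.1 hi with rfl | hi'
    · rcases Finset.mem_insert.1 hl with rfl | hl'
      · exact absurd rfl hil
      · exact hpa l hl'
    · rcases Finset.mem_insert.1 hl with rfl | hl'
      · exact (hpa i hi').symm
      · exact (hG'.pair i hi' l hl' hil).congr (hW i hi') (hW l hl') (hlam i hi') (hlam l hl')
  · rcases Finset.mem_insert.1 hi with rfl | hi'
    · obtain ⟨h1, h2, h3⟩ := hG.size b hb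
      have ht := tt_ge_one P i
      refine ⟨?_, ?_, ?_⟩
      · nlinarith
      · rw [hlama]; nlinarith
      · rcases h3 with h3 | h3
        · left
          exact ⟨hz h3.1 h3.2, by rw [hlama]; exact h3.2⟩
        · right
          nlinarith
    · rw [hW i hi', hlam i hi']
      exact hG'.size i hi'

/-- a new row supported at `a`, attached to `b`. -/
lemma GoodL.new {D r r' : ℝ} {P : V → E3} {S : Finset V} {W' : V → E3}
    {lam' : V → ℝ} {a b : V} (ha : a ∉ S) (hb : b ∈ S)
    (hr : r = ‖P a - P b‖) (hD : 1 ≤ D)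
    (hmin : ∀ l ∈ S, r ≤ ‖P a - P l‖) (hra : r ≤ tt P a) (hr'b : r' ≤ tt P b) (hrr' : r ≤ r')
    (hr' : ∀ l ∈ S, l ≠ b → r' ≤ ‖P b - P l‖)
    (hW : ∀ i ∈ S, W' i = 0) (hlam : ∀ i ∈ S, i ≠ b → lam' i = 0) (hlama : lam' a = lam' b)
    (hE : ‖W' a - lam' b • (P a - P b)‖ ≤ D * r) (hWa : ‖W' a‖ ≤ D * r')
    (hlr : |lam' b| * r ≤ D * r') :
    GoodL (2 * D) r (tt P a) P (insert a S) W' lam' := by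
  have hr0 : 0 ≤ r := hr ▸ norm_nonneg _
  have htba : tt P b ≤ 2 * tt P a := by
    have := tt_le_add' P a b
    rw [← hr] at this; linarith
  have hpb : ∀ l ∈ S, l ≠ b → PairOK (2 * D) r P W' lam' b l := by
    intro l hl hlb
    have := hr' l hl hlb
    right
    rw [hW b hb, hW l hl, hlam l hl hlb]
    refine ⟨?_, ?_, ?_⟩
    · simp; positivity
    · nlinarith
    · simp; positivity
  have hpa : ∀ l ∈ S, PairOK (2 * D) r P W' lam' a l := by
    intro l hl
    by_cases hlb : l = b
    · subst hlb
      left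
      refine ⟨hlama, ?_⟩
      rw [hlama, hW l hl, sub_zero, ← hr]
      nlinarith
    · have hrl := hmin l hl
      have h0 := hr' l hl hlb
      have hbl : ‖P b - P l‖ ≤ 2 * ‖P a - P l‖ := by
        have : P b - P l = (P a - P l) - (P a - P b) := by module
        rw [this]
        refine (norm_sub_le _ _).trans ?_
        rw [← hr]; linarith
      right
      rw [hlama, hW l hl, hlam l hl hlb, sub_zero]
      refine ⟨?_, ?_, ?_⟩
      · nlinarith
      · nlinarith
      · simp; positivity
  have hpo : ∀ i ∈ S, ∀ l ∈ S, i ≠ l → PairOK (2 * D) r P W' lam' i l := by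
    intro i hi l hl hil
    by_cases hib : i = b
    · subst hib; exact hpb l hl (Ne.symm hil)
    · by_cases hlb : l = b
      · subst hlb; exact (hpb i hi hib).symm
      · right
        rw [hW i hi, hW l hl, hlam l hl hlb, hlam i hi hib]
        simp; positivity
  refine ⟨fun i hi l hl hil => ?_, fun i hi => ?_⟩
  · rcases Finset.mem_insert.1 hi with rfl | hi'
    · rcases Finset.mem_insert.1 hl with rfl | hl'
      · exact absurd rfl hil
      · exact hpa l hl'
    · rcases Finset.mem_insert.1 hl with rfl | hl'
      · exact (hpa i hi').symm
      · exact hpo i hi' l hl' hil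
  · have ht := tt_ge_one P a
    have htb := tt_ge_one P b
    have hti := tt_ge_one P i
    rcases Finset.mem_insert.1 hi with rfl | hi'
    · refine ⟨?_, ?_, Or.inr ?_⟩
      · nlinarith
      · rw [hlama]; nlinarith
      · nlinarith
    · by_cases hib : i = b
      · subst hib
        rw [hW i hi']
        refine ⟨by simp; positivity, by nlinarith, Or.inr (by nlinarith)⟩
      · rw [hW i hi', hlam i hi' hib]
        refine ⟨by simp; positivity, by simp; positivity, Or.inl ⟨rfl, rfl⟩⟩

/-- extension of an old row by zero to a vertex attached to the root -/
lemma GoodL.extend0 {C τ r : ℝ} {P : V → E3} {S : Finset V} {W W' : V → E3}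
    {lam lam' : V → ℝ} (hG : GoodL C r τ P S W lam) {a : V} (ha : a ∉ S)
    (hC : 1 ≤ C) (hτ : 0 ≤ τ)
    (hmin : ∀ l ∈ S, tt P a ≤ ‖P a - P l‖)
    (hW : ∀ i ∈ S, W' i = W i) (hlam : ∀ i ∈ S, lam' i = lam i) (hlama : lam' a = 0)
    (hWa : W' a = 0) :
    GoodL (4 * C) r τ P (insert a S) W' lam' := by
  have hG' := hG.mono (show C ≤ 4 * C by linarith) le_rfl hτ
  have hpa : ∀ l ∈ S, PairOK (4 * C) r P W' lam' a l := by
    intro l hl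
    obtain ⟨h1, h2, h3⟩ := hG.size l hl
    have h4 := tt_le_add' P a l
    have h5 := hmin l hl
    have h6 : C * tt P l ≤ C * (2 * ‖P a - P l‖) := by gcongr; linarith
    have h7 : 0 ≤ C * ‖P a - P l‖ := by positivity
    right
    rw [hlama, hlam l hl, hW l hl, hWa]
    refine ⟨?_, ?_, ?_⟩
    · rw [zero_sub, norm_neg]; linarith
    · simp; positivity
    · linarith
  refine ⟨fun i hi l hl hil => ?_, fun i hi => ?_⟩
  · rcases Finset.mem_insert.1 hi with rfl | hi'
    · rcases Finset.mem_insert.1 hl with rfl | hl'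
      · exact absurd rfl hil
      · exact hpa l hl'
    · rcases Finset.mem_insert.1 hl with rfl | hl'
      · exact (hpa i hi').symm
      · exact (hG'.pair i hi' l hl' hil).congr (hW i hi') (hW l hl') (hlam i hi') (hlam l hl')
  · have hti := tt_ge_one P i
    rcases Finset.mem_insert.1 hi with rfl | hi'
    · rw [hWa, hlama]
      refine ⟨by simp; positivity, by simp; positivity, Or.inl ⟨rfl, rfl⟩⟩
    · rw [hW i hi', hlam i hi']
      exact hG'.size i hi'

lemma GoodL.new0 {D r : ℝ} {P : V → E3} {S : Finset V} {W' : V → E3}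
    {lam' : V → ℝ} {a : V} (ha : a ∉ S) (hD : 1 ≤ D)
    (hmin : ∀ l ∈ S, tt P a ≤ ‖P a - P l‖)
    (hW : ∀ i ∈ S, W' i = 0) (hlam : ∀ i, lam' i = 0) (hWa : ‖W' a‖ ≤ D * tt P a) :
    GoodL D r (tt P a) P (insert a S) W' lam' := by
  have hpa : ∀ l ∈ S, PairOK D r P W' lam' a l := by
    intro l hl
    have h5 := hmin l hl
    right
    rw [hlam, hlam, hW l hl, sub_zero]
    refine ⟨by nlinarith, by simp; positivity, by simp; positivity⟩
  refine ⟨fun i hi l hl hil => ?_, fun i hi => ?_⟩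
  · rcases Finset.mem_insert.1 hi with rfl | hi'
    · rcases Finset.mem_insert.1 hl with rfl | hl'
      · exact absurd rfl hil
      · exact hpa l hl'
    · rcases Finset.mem_insert.1 hl with rfl | hl'
      · exact (hpa i hi').symm
      · right
        rw [hW i hi', hW l hl', hlam, hlam]
        simp; positivity
  · have hti := tt_ge_one P i
    rw [hlam]
    rcases Finset.mem_insert.1 hi with rfl | hi'
    · refine ⟨hWa, by simp; positivity, Or.inr (by nlinarith)⟩
    · rw [hW i hi']
      refine ⟨by simp; positivity, by simp; positivity, Or.inl ⟨rfl, rfl⟩⟩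

end CSI

namespace CSI

variable {V : Type*}

structure TData (isK : V → Prop) (B : ℝ) (P T : V → E3) : Prop where
  one_le : 1 ≤ B
  tt_le : ∀ v, isK v → tt P v ≤ B
  T_le : ∀ v, isK v → ‖T v‖ ≤ B
  T_ge : ∀ v, isK v → 1 ≤ B * ‖T v‖
  pair : ∀ a b, isK a → isK b → a ≠ b → ∃ s : ℝ, |s| ≤ B * ‖P a - P b‖ ∧ ‖P a - P b‖ ≤ B * |s| ∧
    ‖T a - T b‖ ≤ B * ‖P a - P b‖ ∧ ‖P a - P b - s • T a‖ ≤ B * ‖P a - P b‖ ^ 2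

noncomputable def blk (isK : V → Prop) (c : V → Fin 3 → V → E3) (v : V) : ℝ :=
  if isK v then |c v 0 v 0| else |Matrix.det (Matrix.of fun j k : Fin 3 => c v j v k)|

def RowsOK (isK : V → Prop) (B ε : ℝ) (P T : V → E3) (S : Finset V) (δ C : ℝ)
    (l : List (V × Option V)) (c : V → Fin 3 → V → E3) (lam : V → Fin 3 → V → ℝ) : Prop :=
  WF l ∧ (∀ v, v ∈ l.map Prod.fst ↔ v ∈ S) ∧
  (∀ v ∈ S, ∀ j, GoodL C δ (tt P v) P S (disp isK T (c v j)) (lam v j)) ∧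
  (l.map Prod.fst).Pairwise (fun u v => ∀ j, c u j v = 0) ∧
  1 ≤ B ^ S.card * (∏ v ∈ S, blk isK c v * tt P v ^ ε) * FF isK ε l P

noncomputable def newc (a : V) (ca : Fin 3 → E3) (xa : V → Fin 3 → E3)
    (c : V → Fin 3 → V → E3) : V → Fin 3 → V → E3 := fun v j u =>
  if v = a then (if u = a then ca j else 0) else (if u = a then xa v j else c v j u)

lemma newc_aa (a : V) (ca : Fin 3 → E3) (xa : V → Fin 3 → E3)
    (c : V → Fin 3 → V → E3) (j) : newc a ca xa c a j a = ca j := by simp [newc]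

lemma newc_au (a : V) (ca : Fin 3 → E3) (xa : V → Fin 3 → E3)
    (c : V → Fin 3 → V → E3) (j) {u : V} (hu : u ≠ a) : newc a ca xa c a j u = 0 := by
  simp [newc, hu]

lemma newc_va (a : V) (ca : Fin 3 → E3) (xa : V → Fin 3 → E3)
    (c : V → Fin 3 → V → E3) (j) {v : V} (hv : v ≠ a) : newc a ca xa c v j a = xa v j := by
  simp [newc, hv]

lemma newc_vu (a : V) (ca : Fin 3 → E3) (xa : V → Fin 3 → E3)
    (c : V → Fin 3 → V → E3) (j) {v u : V} (hv : v ≠ a) (hu : u ≠ a) :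
    newc a ca xa c v j u = c v j u := by
  simp [newc, hv, hu]

lemma step {isK : V → Prop} {B ε : ℝ} {P T : V → E3} {S : Finset V} {δ C C' : ℝ}
    {l : List (V × Option V)} {c : V → Fin 3 → V → E3} {lam : V → Fin 3 → V → ℝ}
    (h : RowsOK isK B ε P T S δ C l c lam) {a : V} (ha : a ∉ S) (o : Option V)
    (ho : ∀ b ∈ o, b ∈ S) (ca : Fin 3 → E3) (xa : V → Fin 3 → E3)
    (lam' : V → Fin 3 → V → ℝ)
    (hgood : ∀ v ∈ insert a S, ∀ j, GoodL C' δ (tt P v) P (insert a S)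
      (disp isK T (newc a ca xa c v j)) (lam' v j))
    (hblk : 1 ≤ B * (blk isK (newc a ca xa c) a * tt P a ^ ε) *
      phi isK ε P a o (l.map Prod.fst)) :
    RowsOK isK B ε P T (insert a S) δ C' ((a, o) :: l) (newc a ca xa c) lam' := by
  obtain ⟨h1, h2, h3, h4, h5⟩ := h
  refine ⟨⟨?_, ?_, h1⟩, ?_, hgood, ?_, ?_⟩
  · rw [h2]; exact ha
  · intro b hb; rw [h2]; exact ho b hb
  · intro v
    simp only [List.map_cons, List.mem_cons, Finset.mem_insert, h2]
  · simp only [List.map_cons, List.pairwise_cons]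
    refine ⟨?_, ?_⟩
    · intro v hv j
      rw [h2] at hv
      exact newc_au _ _ _ _ _ (fun h => ha (h ▸ hv))
    · refine h4.imp_of_mem ?_
      intro u v hu hv huv j
      rw [h2] at hu hv
      have hua : u ≠ a := fun h => ha (h ▸ hu)
      have hva : v ≠ a := fun h => ha (h ▸ hv)
      rw [newc_vu _ _ _ _ _ hua hva]
      exact huv j
  · rw [Finset.prod_insert ha, Finset.card_insert_of_notMem ha]
    have : ∏ v ∈ S, blk isK (newc a ca xa c) v * tt P v ^ ε =
        ∏ v ∈ S, blk isK c v * tt P v ^ ε := by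
      refine Finset.prod_congr rfl fun v hv => ?_
      have hva : v ≠ a := fun h => ha (h ▸ hv)
      simp only [blk, newc_vu _ _ _ _ _ hva hva]
    rw [this]
    show 1 ≤ _ * (phi isK ε P a o (l.map Prod.fst) * FF isK ε l P)
    calc (1 : ℝ) ≤ (B * (blk isK (newc a ca xa c) a * tt P a ^ ε) *
      phi isK ε P a o (l.map Prod.fst)) * (B ^ S.card * (∏ v ∈ S, blk isK c v * tt P v ^ ε) * FF isK ε l P) :=
          one_le_mul_of_one_le_of_one_le hblk h5
      _ = _ := by ring

lemma rnear_le_tt (P : V → E3) (b : V) (l : List V) : rnear P b l ≤ tt P b := by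
  induction l with
  | nil => exact le_rfl
  | cons v l ih =>
    unfold rnear
    split_ifs
    · exact ih
    · exact (min_le_right _ _).trans ih

lemma rnear_le (P : V → E3) (b : V) (l : List V) {v : V} (hv : v ∈ l) (hvb : v ≠ b) :
    rnear P b l ≤ ‖P b - P v‖ := by
  induction l with
  | nil => simp at hv
  | cons u l ih =>
    unfold rnear
    rcases List.mem_cons.1 hv with rfl | hv
    · rw [if_neg hvb, norm_sub_rev (P b)]
      exact min_le_left _ _
    · split_ifs
      · exact ih hv
      · exact (min_le_right _ _).trans (ih hv)

lemma le_rnear (P : V → E3) (b : V) (l : List V) {r : ℝ} (hr : r ≤ tt P b)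
    (h : ∀ v ∈ l, v ≠ b → r ≤ ‖P v - P b‖) : r ≤ rnear P b l := by
  induction l with
  | nil => exact hr
  | cons u l ih =>
    unfold rnear
    split_ifs with hu
    · exact ih fun v hv => h v (List.mem_cons_of_mem _ hv)
    · exact le_min (h u (by simp) hu) (ih fun v hv => h v (List.mem_cons_of_mem _ hv))

/-- matrix determinant for the free block -/
lemma det_block (r q : ℝ) (u : E3) (hu : ‖u‖ = 1) :
    Matrix.det (Matrix.of fun j k : Fin 3 =>
      (r • EuclideanSpace.single j (1 : ℝ) + (u j * q) • u : E3) k) = r ^ 2 * (r + q) := by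
  have h : u 0 ^ 2 + u 1 ^ 2 + u 2 ^ 2 = 1 := by
    have := EuclideanSpace.norm_sq_eq u
    rw [hu] at this
    simp [Fin.sum_univ_three] at this
    linarith
  rw [Matrix.det_fin_three]
  simp
  linear_combination (r ^ 2 * q) * h

lemma exists_min {S : Finset V} (hS : S.Nonempty) (P : V → E3) :
    (∃ a ∈ S, (∀ i ∈ S, tt P a ≤ tt P i) ∧ (∀ i ∈ S, ∀ l ∈ S, i ≠ l → tt P a ≤ ‖P i - P l‖)) ∨
    (∃ a ∈ S, ∃ b ∈ S, a ≠ b ∧ (∀ i ∈ S, ‖P a - P b‖ ≤ tt P i) ∧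
      (∀ i ∈ S, ∀ l ∈ S, i ≠ l → ‖P a - P b‖ ≤ ‖P i - P l‖)) := by
  obtain ⟨a, ha, hmin⟩ := S.exists_min_image (tt P) hS
  by_cases hne : (S.offDiag).Nonempty
  · obtain ⟨p, hp, hpm⟩ := S.offDiag.exists_min_image (fun p => ‖P p.1 - P p.2‖) hne
    obtain ⟨hp1, hp2, hp3⟩ := Finset.mem_offDiag.1 hp
    have hpm' : ∀ i ∈ S, ∀ l ∈ S, i ≠ l → ‖P p.1 - P p.2‖ ≤ ‖P i - P l‖ := fun i hi l hl hil =>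
      hpm (i, l) (Finset.mem_offDiag.2 ⟨hi, hl, hil⟩)
    rcases le_total (tt P a) ‖P p.1 - P p.2‖ with h | h
    · left
      exact ⟨a, ha, hmin, fun i hi l hl hil => h.trans (hpm' i hi l hl hil)⟩
    · right
      exact ⟨p.1, hp1, p.2, hp2, hp3, fun i hi => h.trans (hmin i hi), hpm'⟩
  · left
    refine ⟨a, ha, hmin, fun i hi l hl hil => ?_⟩
    exact absurd ⟨(i, l), Finset.mem_offDiag.2 ⟨hi, hl, hil⟩⟩ hne

end CSI

namespace CSI

variable {V : Type*}

lemma disp_congr {isK : V → Prop} {T : V → E3} {c c' : V → E3} {v : V} (h : c v = c' v) :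
    disp isK T c v = disp isK T c' v := by
  simp [disp, h]

lemma disp_zero {isK : V → Prop} {T : V → E3} {c : V → E3} {v : V} (h : c v = 0) :
    disp isK T c v = 0 := by
  simp [disp, h]

noncomputable def newlam (a : V) (la : Fin 3 → V → ℝ) (xl : V → Fin 3 → ℝ)
    (lam : V → Fin 3 → V → ℝ) : V → Fin 3 → V → ℝ := fun v j u =>
  if v = a then la j u else (if u = a then xl v j else lam v j u)

lemma stepRoot {isK : V → Prop} {B ε : ℝ} {P T : V → E3} {S : Finset V} {δ C : ℝ}
    {l : List (V × Option V)} {c : V → Fin 3 → V → E3} {lam : V → Fin 3 → V → ℝ}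
    (hT : TData isK B P T) (hε : 0 ≤ ε) (hC : 1 ≤ C)
    (h : RowsOK isK B ε P T S δ C l c lam) {a : V} (ha : a ∉ S)
    (hmin : ∀ l ∈ S, tt P a ≤ ‖P a - P l‖) :
    ∃ l' c' lam', RowsOK isK B ε P T (insert a S) δ ((2 * B ^ 3 + 4) * C) l' c' lam' := by
  have hB := hT.one_le
  have hB3 : 1 ≤ B ^ 3 := one_le_pow₀ hB
  have hB3' : B ≤ B ^ 3 := le_self_pow₀ hB (by norm_num)
  have hta := tt_ge_one P a
  have hne : ∀ i ∈ S, i ≠ a := fun i hi h => ha (h ▸ hi)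
  set ca : Fin 3 → E3 := fun j => if isK a then EuclideanSpace.single 0 1 else
    tt P a • EuclideanSpace.single j 1 with hca
  refine ⟨_, _, _, step h ha none (by simp) ca (fun _ _ => 0)
    (newlam a (fun _ _ => 0) (fun _ _ => 0) lam) ?_ ?_⟩
  · intro v hv j
    by_cases hva : v = a
    · subst hva
      refine (GoodL.new0 (D := B) ha hB hmin ?_ ?_ ?_).mono ?_ le_rfl (by linarith)
      · intro i hi
        exact disp_zero (newc_au _ _ _ _ _ (hne i hi))
      · intro i; simp [newlam]
      · unfold disp
        rw [newc_aa]
        by_cases hK : isK v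
        · simp only [hca, hK, if_true]
          simp
          nlinarith [hT.T_le v hK]
        · simp only [hca, hK, if_false]
          rw [norm_smul]
          simp
          rw [abs_of_nonneg (by linarith)]
          nlinarith
      · nlinarith
    · have hvS : v ∈ S := (Finset.mem_insert.1 hv).resolve_left hva
      have htv := tt_ge_one P v
      refine (GoodL.extend0 (h.2.2.1 v hvS j) ha hC (by linarith) hmin ?_ ?_ ?_ ?_).mono ?_ le_rfl (by linarith)
      · intro i hi
        exact disp_congr (newc_vu _ _ _ _ _ hva (hne i hi))
      · intro i hi; simp [newlam, hva, hne i hi]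
      · simp [newlam, hva]
      · exact disp_zero (newc_va _ _ _ _ _ hva)
      · nlinarith
  · unfold blk phi
    simp only [newc_aa]
    by_cases hK : isK a
    · simp only [hca, hK, if_true]
      simp
      have : 1 ≤ tt P a ^ ε := Real.one_le_rpow hta hε
      nlinarith
    · simp only [hca, hK, if_false]
      have h0 : 0 < tt P a := by linarith
      have : Matrix.det (Matrix.of fun j k : Fin 3 =>
        (tt P a • EuclideanSpace.single j (1:ℝ) : E3) k) = tt P a ^ (3:ℕ) := by
        rw [Matrix.det_fin_three]
        simp
        ring
      rw [this, abs_of_nonneg (by positivity)]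
      have h2 : tt P a ^ (3:ℕ) * tt P a ^ ε * tt P a ^ (-(3 + ε)) = 1 := by
        rw [← Real.rpow_natCast, ← Real.rpow_add h0, ← Real.rpow_add h0]
        simp
      rw [mul_assoc, h2]
      linarith

lemma stepFree {isK : V → Prop} {B ε : ℝ} {P T : V → E3} {S : Finset V} {C r : ℝ}
    {l : List (V × Option V)} {c : V → Fin 3 → V → E3} {lam : V → Fin 3 → V → ℝ}
    (hT : TData isK B P T) (hε : 0 ≤ ε) (hC : 1 ≤ C)
    (h : RowsOK isK B ε P T S r C l c lam) {a b : V} (ha : a ∉ S) (hb : b ∈ S)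
    (hr : r = ‖P a - P b‖) (hr0 : 0 < r)
    (hmin : ∀ l ∈ S, r ≤ ‖P a - P l‖) (hmin2 : ∀ i ∈ S, i ≠ b → r ≤ ‖P i - P b‖)
    (hra : r ≤ tt P a) (hrb : r ≤ tt P b) (hK : ¬ isK a) :
    ∃ l' c' lam', RowsOK isK B ε P T (insert a S) r ((2 * B ^ 3 + 4) * C) l' c' lam' := by
  have hB := hT.one_le
  have hB3 : 1 ≤ B ^ 3 := one_le_pow₀ hB
  have hta := tt_ge_one P a
  have hne : ∀ i ∈ S, i ≠ a := fun i hi h => ha (h ▸ hi)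
  set L := l.map Prod.fst with hL
  set r' := rnear P b L with hr'
  have hr'1 : r' ≤ tt P b := rnear_le_tt _ _ _
  have hr'2 : ∀ l ∈ S, l ≠ b → r' ≤ ‖P b - P l‖ := fun v hv hvb =>
    rnear_le P b L ((h.2.1 v).2 hv) hvb
  have hr'3 : r ≤ r' := le_rnear P b L hrb fun v hv hvb => hmin2 v ((h.2.1 v).1 hv) hvb
  set u : E3 := r⁻¹ • (P a - P b) with hu
  have hu1 : ‖u‖ = 1 := by
    rw [hu, norm_smul, ← hr, norm_inv, Real.norm_of_nonneg hr0.le, inv_mul_cancel₀ hr0.ne']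
  have huj : ∀ j, |u j| ≤ 1 := fun j => by
    have := PiLp.norm_apply_le u j
    rwa [hu1] at this
  have hPu : P a - P b = r • u := by rw [hu, smul_smul, mul_inv_cancel₀ hr0.ne', one_smul]
  set ca : Fin 3 → E3 := fun j => r • EuclideanSpace.single j (1 : ℝ) + (u j * (r' - r)) • u with hca
  refine ⟨_, _, _, step h ha (some b) (by simpa using hb) ca
    (fun v j => disp isK T (c v j) b + lam v j b • (P a - P b))
    (newlam a (fun j i => if i = a ∨ i = b then u j * (r' - r) / r else 0)
      (fun v j => lam v j b) lam) ?_ ?_⟩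
  · intro v hv j
    by_cases hva : v = a
    · subst hva
      refine (GoodL.new (D := 1) (r' := r') ha hb hr le_rfl hmin hra hr'1 hr'3 hr'2 ?_ ?_ ?_ ?_ ?_ ?_).mono ?_ le_rfl (by linarith)
      · intro i hi
        exact disp_zero (newc_au _ _ _ _ _ (hne i hi))
      · intro i hi hib; simp [newlam, hib, hne i hi]
      · simp [newlam]
      · unfold disp
        rw [newc_aa, if_neg hK]
        simp only [newlam, if_true, or_true]
        have : ca j - (u j * (r' - r) / r) • (P v - P b) = r • EuclideanSpace.single j (1:ℝ) := by
          rw [hPu, smul_smul, div_mul_cancel₀ _ hr0.ne', hca]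
          simp
        rw [this, norm_smul]
        simp [abs_of_pos hr0]
      · unfold disp
        rw [newc_aa, if_neg hK, hca]
        refine (norm_add_le _ _).trans ?_
        rw [norm_smul, norm_smul, hu1]
        have : |u j * (r' - r)| ≤ r' - r := by
          rw [abs_mul, abs_of_nonneg (sub_nonneg.2 hr'3)]
          nlinarith [huj j]
        simp only [Real.norm_eq_abs, EuclideanSpace.norm_single, abs_one, mul_one, abs_of_pos hr0]
        linarith
      · simp only [newlam, if_true, or_true]
        rw [abs_div, abs_of_pos hr0, div_mul_cancel₀ _ hr0.ne', abs_mul,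
          abs_of_nonneg (sub_nonneg.2 hr'3)]
        nlinarith [huj j]
      · nlinarith
    · have hvS : v ∈ S := (Finset.mem_insert.1 hv).resolve_left hva
      have htv := tt_ge_one P v
      refine (GoodL.extend (D := 0) (h.2.2.1 v hvS j) ha hb hr hC le_rfl (by linarith) hmin hra hrb
        ?_ ?_ ?_ ?_ ?_).mono ?_ le_rfl (by linarith)
      · intro i hi
        exact disp_congr (newc_vu _ _ _ _ _ hva (hne i hi))
      · intro i hi; simp [newlam, hva, hne i hi]
      · simp [newlam, hva]
      · have : disp isK T (newc a ca (fun v j => disp isK T (c v j) b + lam v j b • (P a - P b)) c v j) a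
          = disp isK T (c v j) b + lam v j b • (P a - P b) := by
          conv_lhs => unfold disp
          rw [newc_va _ _ _ _ _ hva, if_neg hK]
          rfl
        rw [this]
        simp
      · intro h1 h2
        unfold disp
        rw [newc_va _ _ _ _ _ hva, if_neg hK]
        show disp isK T (c v j) b + lam v j b • (P a - P b) = 0
        rw [h1, h2]; simp
      · nlinarith
  · unfold blk phi
    simp only [newc_aa]
    simp only [hK, if_false]
    rw [hca, det_block r (r' - r) u hu1, if_pos (by rw [← hr, ← hL, ← hr']; exact hr'3)]
    rw [← hr, ← hL, ← hr']
    have : 1 ≤ tt P a ^ ε := Real.one_le_rpow hta hε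
    have hr'0 : 0 < r' := by linarith
    rw [add_sub_cancel, abs_of_pos (by positivity)]
    have e : B * (r ^ 2 * r' * tt P a ^ ε) * (r ^ 2 * r')⁻¹ = B * tt P a ^ ε := by
      field_simp
    rw [e]
    nlinarith

lemma stepKnot {isK : V → Prop} {B ε : ℝ} {P T : V → E3} {S : Finset V} {C r : ℝ}
    {l : List (V × Option V)} {c : V → Fin 3 → V → E3} {lam : V → Fin 3 → V → ℝ}
    (hT : TData isK B P T) (hε : 0 ≤ ε) (hC : 1 ≤ C)
    (h : RowsOK isK B ε P T S r C l c lam) {a b : V} (ha : a ∉ S) (hb : b ∈ S)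
    (hr : r = ‖P a - P b‖) (hr0 : 0 < r)
    (hmin : ∀ l ∈ S, r ≤ ‖P a - P l‖) (hmin2 : ∀ i ∈ S, i ≠ b → r ≤ ‖P i - P b‖)
    (hra : r ≤ tt P a) (hrb : r ≤ tt P b) (hK : isK a) (hKb : isK b) :
    ∃ l' c' lam', RowsOK isK B ε P T (insert a S) r ((2 * B ^ 3 + 4) * C) l' c' lam' := by
  have hB := hT.one_le
  have hB2 : 1 ≤ B ^ 2 := one_le_pow₀ hB
  have hB23 : B ^ 2 ≤ B ^ 3 := pow_le_pow_right₀ hB (by norm_num)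
  have hB3 : 1 ≤ B ^ 3 := one_le_pow₀ hB
  have hta := tt_ge_one P a
  have hne : ∀ i ∈ S, i ≠ a := fun i hi h => ha (h ▸ hi)
  obtain ⟨s, hs1, hs2, hs3, hs4⟩ := hT.pair a b hK hKb (hne b hb).symm
  rw [← hr] at hs1 hs2 hs3 hs4
  set L := l.map Prod.fst with hL
  set r' := rnear P b L with hr'
  have hr'1 : r' ≤ tt P b := rnear_le_tt _ _ _
  have hr'2 : ∀ l ∈ S, l ≠ b → r' ≤ ‖P b - P l‖ := fun v hv hvb =>
    rnear_le P b L ((h.2.1 v).2 hv) hvb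
  have hr'3 : r ≤ r' := le_rnear P b L hrb fun v hv hvb => hmin2 v ((h.2.1 v).1 hv) hvb
  have hr'0 : 0 < r' := by linarith
  have hr'B : r' ≤ B := hr'1.trans (hT.tt_le b hKb)
  set ca : Fin 3 → E3 := fun j => EuclideanSpace.single 0 (r' / r * s) with hca
  set xa : V → Fin 3 → E3 := fun v j => EuclideanSpace.single 0 (c v j b 0 + lam v j b * s) with hxa
  have hs4' : ‖s • T a - (P a - P b)‖ ≤ B * r ^ 2 := by rwa [norm_sub_rev]
  refine ⟨_, _, _, step h ha (some b) (by simpa using hb) ca xa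
    (newlam a (fun j i => if i = a ∨ i = b then r' / r else 0)
      (fun v j => lam v j b) lam) ?_ ?_⟩
  · intro v hv j
    by_cases hva : v = a
    · subst hva
      have hd : disp isK T (newc v ca xa c v j) v = (r' / r * s) • T v := by
        unfold disp
        rw [newc_aa, if_pos hK]
        simp [hca]
      refine (GoodL.new (D := B ^ 2) (r' := r') ha hb hr hB2 hmin hra hr'1 hr'3 hr'2 ?_ ?_ ?_ ?_ ?_ ?_).mono ?_ le_rfl (by linarith)
      · intro i hi
        exact disp_zero (newc_au _ _ _ _ _ (hne i hi))
      · intro i hi hib; simp [newlam, hib, hne i hi]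
      · simp [newlam]
      · rw [hd]
        simp only [newlam, if_true, or_true]
        have : (r' / r * s) • T v - (r' / r) • (P v - P b) =
          (r' / r) • (s • T v - (P v - P b)) := by module
        rw [this, norm_smul, Real.norm_of_nonneg (by positivity)]
        calc r' / r * ‖s • T v - (P v - P b)‖ ≤ r' / r * (B * r ^ 2) := by gcongr
          _ = r' * B * r := by field_simp
          _ ≤ B * B * r := by gcongr
          _ = B ^ 2 * r := by ring
      · rw [hd, norm_smul, Real.norm_eq_abs, abs_mul, abs_of_nonneg (by positivity : 0 ≤ r' / r)]
        calc r' / r * |s| * ‖T v‖ ≤ r' / r * (B * r) * B := by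
              gcongr; exact hT.T_le v hK
          _ = B ^ 2 * r' := by field_simp
      · simp only [newlam, if_true, or_true]
        rw [abs_of_nonneg (by positivity), div_mul_cancel₀ _ hr0.ne']
        nlinarith
      · nlinarith
    · have hvS : v ∈ S := (Finset.mem_insert.1 hv).resolve_left hva
      have htv := tt_ge_one P v
      have hd : disp isK T (newc a ca xa c v j) a = (c v j b 0 + lam v j b * s) • T a := by
        unfold disp
        rw [newc_va _ _ _ _ _ hva, if_pos hK]
        simp [hxa]
      have hdb : disp isK T (c v j) b = c v j b 0 • T b := by
        simp [disp, hKb]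
      obtain ⟨hz1, hz2, hz3⟩ := (h.2.2.1 v hvS j).size b hb
      have hcb : |c v j b 0| ≤ B ^ 2 * C := by
        have h1 := hT.T_ge b hKb
        rw [hdb, norm_smul, Real.norm_eq_abs] at hz1
        calc |c v j b 0| ≤ |c v j b 0| * (B * ‖T b‖) := le_mul_of_one_le_right (abs_nonneg _) h1
          _ = B * (|c v j b 0| * ‖T b‖) := by ring
          _ ≤ B * (C * tt P b) := by gcongr
          _ ≤ B * (C * B) := by gcongr; exact hT.tt_le b hKb
          _ = B ^ 2 * C := by ring
      have hlb : |lam v j b| * r ≤ C * B := hz2.trans (by gcongr; exact hT.tt_le b hKb)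
      refine (GoodL.extend (D := 2 * B ^ 3 * C) (h.2.2.1 v hvS j) ha hb hr hC (by positivity)
        (by linarith) hmin hra hrb ?_ ?_ ?_ ?_ ?_).mono ?_ le_rfl (by linarith)
      · intro i hi
        exact disp_congr (newc_vu _ _ _ _ _ hva (hne i hi))
      · intro i hi; simp [newlam, hva, hne i hi]
      · simp [newlam, hva]
      · rw [hd, hdb]
        have : (c v j b 0 + lam v j b * s) • T a - c v j b 0 • T b - lam v j b • (P a - P b) =
          c v j b 0 • (T a - T b) + lam v j b • (s • T a - (P a - P b)) := by module
        rw [this]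
        refine (norm_add_le _ _).trans ?_
        rw [norm_smul, norm_smul, Real.norm_eq_abs, Real.norm_eq_abs]
        calc |c v j b 0| * ‖T a - T b‖ + |lam v j b| * ‖s • T a - (P a - P b)‖
            ≤ (B ^ 2 * C) * (B * r) + |lam v j b| * (B * r ^ 2) := by gcongr
          _ = B ^ 3 * C * r + (|lam v j b| * r) * (B * r) := by ring
          _ ≤ B ^ 3 * C * r + (C * B) * (B * r) := by gcongr
          _ = B ^ 3 * C * r + B ^ 2 * (C * r) := by ring
          _ ≤ B ^ 3 * C * r + B ^ 3 * (C * r) := by gcongr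
          _ = _ := by ring
      · intro h1 h2
        rw [hd, h2]
        rw [hdb] at h1
        have hTb : T b ≠ 0 := by
          intro h0
          have := hT.T_ge b hKb
          rw [h0] at this; simp at this; linarith
        rw [(smul_eq_zero.1 h1).resolve_right hTb]; simp
      · nlinarith
  · unfold blk phi
    simp only [newc_aa]
    simp only [hK, if_true]
    rw [if_pos (by rw [← hr, ← hL, ← hr']; exact hr'3)]
    rw [← hL, ← hr', hca]
    have : 1 ≤ tt P a ^ ε := Real.one_le_rpow hta hε
    simp only [EuclideanSpace.single_apply, if_true]
    rw [abs_mul, abs_of_nonneg (by positivity : 0 ≤ r' / r)]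
    have e : B * (r' / r * |s| * tt P a ^ ε) * r'⁻¹ = (B * |s|) / r * tt P a ^ ε := by
      field_simp
    rw [e]
    have : 1 ≤ (B * |s|) / r := by rw [le_div_iff₀ hr0]; linarith
    nlinarith

theorem rows_exist {isK : V → Prop} {B ε : ℝ} {P T : V → E3}
    (hT : TData isK B P T) (hε : 0 ≤ ε) (hinj : Function.Injective P) :
    ∀ (N : ℕ) (S : Finset V), S.card = N → ∀ δ : ℝ, (∀ i ∈ S, δ ≤ tt P i) →
      (∀ i ∈ S, ∀ l ∈ S, i ≠ l → δ ≤ ‖P i - P l‖) →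
      ∃ l c lam, RowsOK isK B ε P T S δ ((2 * B ^ 3 + 4) ^ N) l c lam := by
  have hB := hT.one_le
  have hA : 1 ≤ 2 * B ^ 3 + 4 := by nlinarith [one_le_pow₀ hB (n := 3)]
  intro N
  induction N with
  | zero =>
    intro S hS δ _ _
    rw [Finset.card_eq_zero] at hS
    subst hS
    refine ⟨[], fun _ _ _ => 0, fun _ _ _ => 0, trivial, by simp, by simp, by simp, by simp [FF]⟩
  | succ N ih =>
    intro S hS δ hδ1 hδ2
    have hne : S.Nonempty := by rw [← Finset.card_pos]; omega
    have hC : 1 ≤ (2 * B ^ 3 + 4) ^ N := one_le_pow₀ hA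
    rw [pow_succ']
    have mono : ∀ δ' l c lam C, RowsOK isK B ε P T S δ' C l c lam → δ ≤ δ' →
        RowsOK isK B ε P T S δ C l c lam := by
      rintro δ' l c lam C ⟨h1, h2, h3, h4, h5⟩ hd
      exact ⟨h1, h2, fun v hv j => (h3 v hv j).mono le_rfl hd (by linarith [tt_ge_one P v]), h4, h5⟩
    have main : ∀ a ∈ S, ∀ b ∈ S, a ≠ b → (∀ i ∈ S, ‖P a - P b‖ ≤ tt P i) →
        (∀ i ∈ S, ∀ l ∈ S, i ≠ l → ‖P a - P b‖ ≤ ‖P i - P l‖) → (isK a → isK b) →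
        ∃ l c lam, RowsOK isK B ε P T S δ ((2 * B ^ 3 + 4) * (2 * B ^ 3 + 4) ^ N) l c lam := by
      intro a ha b hb hab h1 h2 hK
      have hcard : (S.erase a).card = N := by rw [Finset.card_erase_of_mem ha]; omega
      obtain ⟨l, c, lam, h⟩ := ih (S.erase a) hcard ‖P a - P b‖
        (fun i hi => h1 i (Finset.mem_of_mem_erase hi))
        (fun i hi l hl => h2 i (Finset.mem_of_mem_erase hi) l (Finset.mem_of_mem_erase hl))
      have hr0 : 0 < ‖P a - P b‖ := norm_pos_iff.2 (sub_ne_zero.2 fun h => hab (hinj h))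
      have hbS : b ∈ S.erase a := Finset.mem_erase.2 ⟨hab.symm, hb⟩
      have hm1 : ∀ l ∈ S.erase a, ‖P a - P b‖ ≤ ‖P a - P l‖ := fun l hl =>
        h2 a ha l (Finset.mem_of_mem_erase hl) (Finset.ne_of_mem_erase hl).symm
      have hm2 : ∀ i ∈ S.erase a, i ≠ b → ‖P a - P b‖ ≤ ‖P i - P b‖ := fun i hi hib =>
        h2 i (Finset.mem_of_mem_erase hi) b hb hib
      have hna : a ∉ S.erase a := Finset.notMem_erase a S
      have : ∃ l' c' lam', RowsOK isK B ε P T (insert a (S.erase a)) ‖P a - P b‖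
          ((2 * B ^ 3 + 4) * (2 * B ^ 3 + 4) ^ N) l' c' lam' := by
        by_cases hKa : isK a
        · exact stepKnot hT hε hC h hna hbS rfl hr0 hm1 hm2 (h1 a ha) (h1 b hb) hKa (hK hKa)
        · exact stepFree hT hε hC h hna hbS rfl hr0 hm1 hm2 (h1 a ha) (h1 b hb) hKa
      rw [Finset.insert_erase ha] at this
      obtain ⟨l', c', lam', h'⟩ := this
      exact ⟨l', c', lam', mono _ _ _ _ _ h' (hδ2 a ha b hb hab)⟩
    rcases exists_min hne P with ⟨a, ha, h1, h2⟩ | ⟨a, ha, b, hb, hab, h1, h2⟩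
    · have hcard : (S.erase a).card = N := by rw [Finset.card_erase_of_mem ha]; omega
      obtain ⟨l, c, lam, h⟩ := ih (S.erase a) hcard (tt P a)
        (fun i hi => h1 i (Finset.mem_of_mem_erase hi))
        (fun i hi l hl => h2 i (Finset.mem_of_mem_erase hi) l (Finset.mem_of_mem_erase hl))
      obtain ⟨l', c', lam', h'⟩ := stepRoot hT hε hC h (Finset.notMem_erase a S) fun l hl =>
        h2 a ha l (Finset.mem_of_mem_erase hl) (Finset.ne_of_mem_erase hl).symm
      rw [Finset.insert_erase ha] at h'
      exact ⟨l', c', lam', mono _ _ _ _ _ h' (hδ1 a ha)⟩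
    · by_cases hK : isK a → isK b
      · exact main a ha b hb hab h1 h2 hK
      · push Not at hK
        refine main b hb a ha hab.symm ?_ ?_ (fun h => absurd h hK.2)
        · rw [norm_sub_rev]; exact h1
        · rw [norm_sub_rev]; exact h2

end CSI

namespace CSI

lemma periodic_bdd {E : Type*} [SeminormedAddCommGroup E] {f : ℝ → E} (hf : Continuous f)
    (hp : Function.Periodic f 1) : ∃ B, ∀ x, ‖f x‖ ≤ B := by
  obtain ⟨B, hB⟩ := (hp.compact_of_continuous one_ne_zero hf).isBounded.exists_norm_le
  exact ⟨B, fun x => hB _ ⟨x, rfl⟩⟩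

lemma periodic_deriv {f : ℝ → E3} (hp : Function.Periodic f 1) :
    Function.Periodic (deriv f) 1 := by
  intro x
  have : (fun y => f (y + 1)) = f := funext hp
  rw [← deriv_comp_add_const, this]

noncomputable def dd (x y : ℝ) : ℝ := min |x - y| (min |x - y + 1| |x - y - 1|)

lemma dd_cases (x y : ℝ) : ∃ m : ℝ, (m = 0 ∨ m = 1 ∨ m = -1) ∧ dd x y = |x + m - y| := by
  unfold dd
  rcases min_choice |x - y| (min |x - y + 1| |x - y - 1|) with h | h
  · exact ⟨0, by simp, by rw [h]; simp⟩
  · rcases min_choice |x - y + 1| |x - y - 1| with h' | h'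
    · exact ⟨1, by simp, by rw [h, h']; congr 1; ring⟩
    · exact ⟨-1, by simp, by rw [h, h']; congr 1; ring⟩

lemma per_m {f : ℝ → E3} (hp : Function.Periodic f 1) {m : ℝ} (hm : m = 0 ∨ m = 1 ∨ m = -1) (x : ℝ) :
    f (x + m) = f x := by
  rcases hm with rfl | rfl | rfl
  · simp
  · exact hp x
  · have := hp (x + -1); rw [← this]; congr 1; ring

structure KC (K : ℝ → E3) (B : ℝ) : Prop where
  one_le : 1 ≤ B
  tt_le : ∀ x, 1 + ‖K x‖ ≤ B
  d_le : ∀ x, ‖deriv K x‖ ≤ B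
  d_ge : ∀ x, 1 ≤ B * ‖deriv K x‖
  lip : ∀ x y, ‖deriv K x - deriv K y‖ ≤ B * |x - y|
  lip0 : ∀ x y, ‖K x - K y‖ ≤ B * |x - y|
  taylor : ∀ x y, ‖K x - K y - (x - y) • deriv K x‖ ≤ B * |x - y| ^ 2
  low : ∀ x ∈ Set.Icc (0:ℝ) 1, ∀ y ∈ Set.Icc (0:ℝ) 1, dd x y ≤ B * ‖K x - K y‖

lemma exists_KC {K : ℝ → E3} (hK : IsKnot K) : ∃ B, KC K B := by
  have hs1 : ContDiff ℝ 1 (deriv K) := by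
    have := hK.smooth.of_le (m := 2) (WithTop.coe_le_coe.2 (le_top : (2:ℕ∞) ≤ ⊤))
    rw [show (2 : WithTop ℕ∞) = 1 + 1 by norm_num, contDiff_succ_iff_deriv] at this
    exact this.2.2
  have hc0 : Continuous K := hK.smooth.continuous
  have hd0 : Differentiable ℝ K := hK.smooth.differentiable (by simp)
  have hd1 : Differentiable ℝ (deriv K) := hs1.differentiable (by simp)
  have hc1 : Continuous (deriv K) := hd1.continuous
  have hc2 : Continuous (deriv (deriv K)) := hs1.continuous_deriv le_rfl
  have hp1 := periodic_deriv hK.periodic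
  have hp2 := periodic_deriv hp1
  obtain ⟨B0, h0⟩ := periodic_bdd hc0 hK.periodic
  obtain ⟨B1, h1⟩ := periodic_bdd hc1 hp1
  obtain ⟨B2, h2⟩ := periodic_bdd hc2 hp2
  obtain ⟨B3, h3⟩ := periodic_bdd (f := fun x => ‖deriv K x‖⁻¹)
    (hc1.norm.inv₀ (fun x => norm_ne_zero_iff.2 (hK.deriv_ne x)))
    (fun x => by simp [hp1 x])
  have hB1 : 0 ≤ B1 := (norm_nonneg _).trans (h1 0)
  have hB2 : 0 ≤ B2 := (norm_nonneg _).trans (h2 0)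
  have hB0 : 0 ≤ B0 := (norm_nonneg _).trans (h0 0)
  have hB3 : 0 < B3 := lt_of_lt_of_le (norm_pos_iff.2 (inv_ne_zero (norm_ne_zero_iff.2 (hK.deriv_ne 0)))) (h3 0)
  have hdl : ∀ x, 1 ≤ B3 * ‖deriv K x‖ := by
    intro x
    have hp : 0 < ‖deriv K x‖ := norm_pos_iff.2 (hK.deriv_ne x)
    have := h3 x
    rw [norm_inv, norm_norm, inv_le_iff_one_le_mul₀ hp] at this
    exact this
  have hlip : ∀ x y, ‖deriv K x - deriv K y‖ ≤ B2 * |x - y| := by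
    intro x y
    exact convex_univ.norm_image_sub_le_of_norm_deriv_le (fun x _ => hd1 x) (fun x _ => h2 x)
      (Set.mem_univ y) (Set.mem_univ x)
  have hlip0 : ∀ x y, ‖K x - K y‖ ≤ B1 * |x - y| := by
    intro x y
    exact convex_univ.norm_image_sub_le_of_norm_deriv_le (fun x _ => hd0 x) (fun x _ => h1 x)
      (Set.mem_univ y) (Set.mem_univ x)
  have htay : ∀ x y, ‖K x - K y - (x - y) • deriv K x‖ ≤ B2 * |x - y| ^ 2 := by
    intro x y
    have := (convex_uIcc y x).norm_image_sub_le_of_norm_hasDerivWithin_le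
      (f := fun t => K t - t • deriv K x) (f' := fun t => deriv K t - deriv K x) (C := B2 * |x - y|)
      (fun t _ => by
        have := ((hd0 t).hasDerivAt.sub ((hasDerivAt_id t).smul_const (deriv K x))).hasDerivWithinAt
          (s := Set.uIcc y x)
        simp only [one_smul] at this; exact this)
      (fun t ht => (hlip t x).trans (by
        gcongr B2 * ?_
        have := Set.abs_sub_right_of_mem_uIcc ht
        rw [abs_sub_comm t x]
        exact this))
      Set.left_mem_uIcc Set.right_mem_uIcc
    rw [Real.norm_eq_abs] at this
    calc _ = _ := by congr 1; module
      _ ≤ _ := this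
      _ = _ := by ring
  -- away from the diagonal
  set η : ℝ := 1 / (2 * B3 * (B2 + 1)) with hη
  have hη0 : 0 < η := by positivity
  have hcomp : IsCompact ((Set.Icc (0:ℝ) 1 ×ˢ Set.Icc (0:ℝ) 1) ∩ {p : ℝ × ℝ | η ≤ dd p.1 p.2}) := by
    apply (isCompact_Icc.prod isCompact_Icc).inter_right
    apply isClosed_le continuous_const
    unfold dd
    fun_prop
  have hpos : ∀ p ∈ ((Set.Icc (0:ℝ) 1 ×ˢ Set.Icc (0:ℝ) 1) ∩ {p : ℝ × ℝ | η ≤ dd p.1 p.2}),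
      0 < ‖K p.1 - K p.2‖ := by
    rintro ⟨x, y⟩ ⟨⟨⟨hx0, hx1⟩, ⟨hy0, hy1⟩⟩, hd⟩
    simp only at *
    rw [norm_pos_iff, sub_ne_zero]
    intro he
    have hd0 : dd x y ≤ 0 := by
      have K1 : K 1 = K 0 := by simpa using hK.periodic 0
      rcases eq_or_lt_of_le hx1 with rfl | hx
      · rcases eq_or_lt_of_le hy1 with rfl | hy
        · unfold dd; simp
        · have := hK.injOn (x₁ := 0) (by simp) ⟨hy0, hy⟩ (by rw [← K1, he])
          subst this
          unfold dd; simp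
      · rcases eq_or_lt_of_le hy1 with rfl | hy
        · have := hK.injOn (x₁ := 0) (by simp) ⟨hx0, hx⟩ (by rw [← K1, he])
          subst this
          unfold dd; simp
        · have := hK.injOn ⟨hx0, hx⟩ ⟨hy0, hy⟩ he
          subst this
          unfold dd; simp
    simp only [Set.mem_setOf_eq] at hd
    linarith
  obtain ⟨κ, hκ0, hκ⟩ : ∃ κ > 0, ∀ p ∈ ((Set.Icc (0:ℝ) 1 ×ˢ Set.Icc (0:ℝ) 1) ∩ {p : ℝ × ℝ | η ≤ dd p.1 p.2}),
      κ ≤ ‖K p.1 - K p.2‖ := by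
    obtain ⟨κ, h, h'⟩ := hcomp.exists_forall_le' (f := fun p : ℝ × ℝ => ‖K p.1 - K p.2‖) (a := 0)
      (by fun_prop) hpos
    exact ⟨κ, h, h'⟩
  have hlow : ∀ x ∈ Set.Icc (0:ℝ) 1, ∀ y ∈ Set.Icc (0:ℝ) 1, dd x y ≤ (2 * B3 + 1 / κ) * ‖K x - K y‖ := by
    intro x hx y hy
    rcases le_or_gt η (dd x y) with h | h
    · have h1 := hκ (x, y) ⟨⟨hx, hy⟩, h⟩
      simp only at h1
      have h2 : dd x y ≤ 1 := by
        unfold dd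
        apply (min_le_left _ _).trans
        rw [abs_le]; constructor <;> linarith [hx.1, hx.2, hy.1, hy.2]
      have : 1 ≤ 1 / κ * ‖K x - K y‖ := by
        rw [one_div, inv_mul_eq_div, le_div_iff₀ hκ0]; linarith
      have : 0 ≤ 2 * B3 * ‖K x - K y‖ := by positivity
      nlinarith
    · obtain ⟨m, hm, hd⟩ := dd_cases x y
      rw [hd] at h ⊢
      have e := per_m hK.periodic hm x
      set s := x + m - y with hs
      have t := htay (x + m) y
      rw [e, ← hs] at t
      have t2 := norm_sub_norm_le (s • deriv K (x+m)) (s • deriv K (x+m) - (K x - K y))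
      rw [sub_sub_cancel, norm_sub_rev _ (K x - K y), norm_smul, Real.norm_eq_abs] at t2
      have t3 := hdl (x + m)
      have t4 : B3 * (B2 * |s| ^ 2) ≤ |s| / 2 := by
        have : B3 * (B2 + 1) * |s| ≤ 1 / 2 := by
          calc _ ≤ B3 * (B2 + 1) * η := by gcongr
            _ = 1 / 2 := by rw [hη]; field_simp
        have h5 : B3 * B2 * |s| ≤ 1 / 2 := by nlinarith [abs_nonneg s]
        nlinarith [abs_nonneg s]
      have t5 : |s| ≤ B3 * (|s| * ‖deriv K (x + m)‖) := by nlinarith [abs_nonneg s]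
      have t6 : |s| / 2 ≤ B3 * ‖K x - K y‖ := by nlinarith
      have : 0 ≤ 1 / κ * ‖K x - K y‖ := by positivity
      nlinarith
  have hκ' : 0 < 1 / κ := by positivity
  have key : ∀ {a b c d: ℝ}, 0 ≤ c → a ≤ b * c → b ≤ d → a ≤ d * c := by
    intro a b c d h1 h2 h3
    exact h2.trans (mul_le_mul_of_nonneg_right h3 h1)
  refine ⟨1 + B0 + B1 + B2 + 2 * B3 + 1 / κ, by linarith, fun x => by linarith [h0 x],
    fun x => by linarith [h1 x], fun x => key (norm_nonneg _) (hdl x) (by linarith),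
    fun x y => key (abs_nonneg _) (hlip x y) (by linarith),
    fun x y => key (abs_nonneg _) (hlip0 x y) (by linarith),
    fun x y => key (by positivity) (htay x y) (by linarith),
    fun x hx y hy => key (norm_nonneg _) (hlow x hx y hy) (by linarith)⟩

lemma KC.TData {V : Type*} {isK : V → Prop} {K : ℝ → E3} {B : ℝ} (hp : Function.Periodic K 1)
    (h : KC K B) {x : V → ℝ} (hx : ∀ v, isK v → x v ∈ Set.Icc (0:ℝ) 1)
    {P T : V → E3} (hP : ∀ v, isK v → P v = K (x v)) (hT : ∀ v, isK v → T v = deriv K (x v)) :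
    TData isK (B ^ 3) P T := by
  have h1 := h.one_le
  have hB : B ≤ B ^ 3 := le_self_pow₀ h1 (by norm_num)
  have hB2 : B ^ 2 ≤ B ^ 3 := pow_le_pow_right₀ h1 (by norm_num)
  refine ⟨one_le_pow₀ h1, ?_, ?_, ?_, ?_⟩
  · intro v hv
    unfold tt; rw [hP v hv]; exact (h.tt_le _).trans hB
  · intro v hv; rw [hT v hv]; exact (h.d_le _).trans hB
  · intro v hv; rw [hT v hv]; exact (h.d_ge _).trans (by gcongr)
  · intro a b ha hb _
    rw [hP a ha, hP b hb, hT a ha, hT b hb]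
    have hl := h.low _ (hx a ha) _ (hx b hb)
    obtain ⟨m, hm, hd⟩ := dd_cases (x a) (x b)
    rw [hd] at hl
    have e1 := per_m hp hm (x a)
    have e2 := per_m (periodic_deriv hp) hm (x a)
    have l1 := h.lip (x a + m) (x b)
    have l2 := h.lip0 (x a + m) (x b)
    have l3 := h.taylor (x a + m) (x b)
    rw [e2] at l1
    rw [e1] at l2
    rw [e1, e2] at l3
    have r0 := norm_nonneg (K (x a) - K (x b))
    have s0 := abs_nonneg (x a + m - x b)
    refine ⟨x a + m - x b, ?_, ?_, ?_, ?_⟩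
    · exact hl.trans (by gcongr)
    · exact l2.trans (by gcongr)
    · apply l1.trans
      calc _ ≤ B * (B * ‖K (x a) - K (x b)‖) := by gcongr
        _ = B ^ 2 * ‖K (x a) - K (x b)‖ := by ring
        _ ≤ _ := by gcongr
    · apply l3.trans
      calc _ ≤ B * (B * ‖K (x a) - K (x b)‖) ^ 2 := by gcongr
        _ = _ := by ring

end CSI

namespace CSI

noncomputable def NN (u : E3) : E3 := ‖u‖⁻¹ • u

lemma NN_hasFDerivAt {u : E3} (hu : u ≠ 0) : ∃ A : E3 →L[ℝ] E3, HasFDerivAt NN A u ∧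
    A u = 0 ∧ ∀ v, ‖A v‖ ≤ 2 * ‖v‖ / ‖u‖ := by
  have hr : 0 < ‖u‖ := norm_pos_iff.2 hu
  have hd : DifferentiableAt ℝ (fun x : E3 => ‖x‖) u :=
    (contDiffAt_norm ℝ (n := 1) hu).differentiableAt (by simp)
  have h1 := hd.hasFDerivAt
  have h2 := (hasDerivAt_inv hr.ne').comp_hasFDerivAt u h1
  have h3 := h2.smul (hasFDerivAt_id u)
  refine ⟨_, h3, ?_, ?_⟩
  · have e : fderiv ℝ (fun x : E3 => ‖x‖) u u = ‖u‖ := DifferentiableAt.fderiv_norm_self hd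
    simp [e]
    field_simp
    simp
  · intro v
    have hl : ‖fderiv ℝ (fun x : E3 => ‖x‖) u v‖ ≤ ‖v‖ := by
      have := norm_fderiv_le_of_lipschitz ℝ (f := fun x : E3 => ‖x‖) (x₀ := u) lipschitzWith_one_norm
      calc _ ≤ _ := ContinuousLinearMap.le_opNorm _ _
        _ ≤ 1 * ‖v‖ := by gcongr; simpa using this
        _ = _ := one_mul _
    simp
    refine (norm_add_le _ _).trans ?_
    rw [norm_smul, norm_neg, norm_smul, norm_mul, norm_inv, norm_inv, norm_pow, norm_norm]
    calc _ ≤ ‖u‖⁻¹ * ‖v‖ + (‖u‖^2)⁻¹ * ‖v‖ * ‖u‖ := by gcongr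
      _ = _ := by field_simp; ring

variable {V : Type*} [Fintype V]

lemma edge_bound {C δ τ : ℝ} (hC : 1 ≤ C) (hτ : 0 ≤ τ) {P W : V → E3} {lam : V → ℝ}
    (h : GoodL C δ τ P Finset.univ W lam)
    {i l : V} (hil : P i ≠ P l) {A : E3 →L[ℝ] E3} (hA0 : A (P i - P l) = 0)
    (hA : ∀ v, ‖A v‖ ≤ 2 * ‖v‖ / ‖P i - P l‖) :
    ‖A (W i - W l)‖ ≤ 4 * C ^ 2 * (τ / max (tt P i) (tt P l)) := by
  have hne : i ≠ l := fun h => hil (by rw [h])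
  have hr : 0 < ‖P i - P l‖ := norm_pos_iff.2 (sub_ne_zero.2 hil)
  have t1 := tt_ge_one P i
  have t2 := tt_ge_one P l
  set M := max (tt P i) (tt P l) with hM
  have hM0 : 0 < M := lt_of_lt_of_le (by linarith) (le_max_left _ _)
  have hp : ‖A (W i - W l)‖ ≤ 2 * C := by
    rcases h.pair i (Finset.mem_univ _) l (Finset.mem_univ _) hne with ⟨h1, h2⟩ | ⟨h1, h2, h3⟩
    · have : A (W i - W l) = A (W i - W l - lam i • (P i - P l)) := by
        rw [map_sub A _ (lam i • _), map_smul, hA0]; simp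
      rw [this]
      refine (hA _).trans ?_
      rw [div_le_iff₀ hr]; nlinarith
    · refine (hA _).trans ?_
      rw [div_le_iff₀ hr]; nlinarith
  have hfin : M ≤ 2 * C * τ → ‖A (W i - W l)‖ ≤ 4 * C ^ 2 * (τ / M) := by
    intro hle
    refine hp.trans ?_
    rw [mul_div_assoc', le_div_iff₀ hM0]
    nlinarith
  obtain ⟨a1, -, a3⟩ := h.size i (Finset.mem_univ _)
  obtain ⟨b1, -, b3⟩ := h.size l (Finset.mem_univ _)
  rcases a3 with ⟨a3, -⟩ | a3 <;> rcases b3 with ⟨b3, -⟩ | b3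
  · rw [a3, b3]; simp; positivity
  · by_cases hc : tt P i ≤ 2 * tt P l
    · exact hfin (max_le (by nlinarith) (by nlinarith))
    · push Not at hc
      have : M = tt P i := max_eq_left (by linarith)
      have h4 := tt_le_add P i l
      refine (hA _).trans ?_
      rw [a3, zero_sub, norm_neg, mul_div_assoc', div_le_div_iff₀ hr hM0, this]
      have : ‖W l‖ ≤ C * (C * τ) := b1.trans (by gcongr)
      have h0 : 0 ≤ C * (C * τ) := by positivity
      calc 2 * ‖W l‖ * tt P i ≤ 2 * (C * (C * τ)) * (2 * ‖P i - P l‖) := by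
            gcongr; linarith
        _ = _ := by ring
  · by_cases hc : tt P l ≤ 2 * tt P i
    · exact hfin (max_le (by nlinarith) (by nlinarith))
    · push Not at hc
      have : M = tt P l := max_eq_right (by linarith)
      have h4 := tt_le_add' P i l
      refine (hA _).trans ?_
      rw [b3, sub_zero, mul_div_assoc', div_le_div_iff₀ hr hM0, this]
      have : ‖W i‖ ≤ C * (C * τ) := a1.trans (by gcongr)
      have h0 : 0 ≤ C * (C * τ) := by positivity
      calc 2 * ‖W i‖ * tt P l ≤ 2 * (C * (C * τ)) * (2 * ‖P i - P l‖) := by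
            gcongr; linarith
        _ = _ := by ring
  · exact hfin (max_le (by nlinarith) (by nlinarith))

section diag
variable {n : ℕ} (D : Diagram n) (K : ℝ → E3)

noncomputable def toConf (c : Fin (2 * n) → E3) : D.Config := (fun v => c v 0, fun v => c v)

noncomputable def TT (z : D.Config) (v : Fin (2 * n)) : E3 :=
  if h : D.IsIntervalVertex v then deriv K (z.1 ⟨v, h⟩) else 0

lemma pt_hasFDerivAt (hK : Differentiable ℝ K) (z : D.Config) (i : Fin (2 * n)) :
    ∃ A : D.Config →L[ℝ] E3, HasFDerivAt (fun z => D.pt K z i) A z ∧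
      ∀ c, A (toConf D c) = disp D.IsIntervalVertex (TT D K z) c i := by
  by_cases h : D.IsIntervalVertex i
  · simp only [Diagram.pt, dif_pos h]
    let A0 : D.Config →L[ℝ] ℝ :=
      (ContinuousLinearMap.proj (R := ℝ) (φ := fun _ : D.IntV => ℝ) ⟨i, h⟩).comp
        (ContinuousLinearMap.fst ℝ (D.IntV → ℝ) (D.FreeV → E3))
    have h1 : HasFDerivAt (fun z : D.Config => z.1 ⟨i, h⟩) A0 z := A0.hasFDerivAt
    have h2 := (hK (z.1 ⟨i, h⟩)).hasDerivAt.hasFDerivAt.comp z h1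
    refine ⟨_, h2, ?_⟩
    intro c
    simp [disp, h, TT, toConf, A0]
  · simp only [Diagram.pt, dif_neg h]
    let A0 : D.Config →L[ℝ] E3 :=
      (ContinuousLinearMap.proj (R := ℝ) (φ := fun _ : D.FreeV => E3) ⟨i, h⟩).comp
        (ContinuousLinearMap.snd ℝ (D.IntV → ℝ) (D.FreeV → E3))
    have h1 : HasFDerivAt (fun z : D.Config => z.2 ⟨i, h⟩) A0 z := A0.hasFDerivAt
    refine ⟨_, h1, ?_⟩
    intro c
    simp [disp, h, toConf, A0]

lemma edgeDir_bound (hK : Differentiable ℝ K) (z : D.Config) (e : Sym2 (Fin (2 * n)))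
    (he : D.pt K z (emax e) ≠ D.pt K z (emin e)) {C δ τ : ℝ} (hC : 1 ≤ C) (hτ : 0 ≤ τ)
    {c : Fin (2 * n) → E3} {lam : Fin (2 * n) → ℝ}
    (h : GoodL C δ τ (D.pt K z) Finset.univ (disp D.IsIntervalVertex (TT D K z) c) lam) :
    ‖fderiv ℝ (D.edgeDir K e) z (toConf D c)‖ ≤
      4 * C ^ 2 * (τ / max (tt (D.pt K z) (emax e)) (tt (D.pt K z) (emin e))) := by
  obtain ⟨A1, hA1, hA1'⟩ := pt_hasFDerivAt D K hK z (emax e)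
  obtain ⟨A2, hA2, hA2'⟩ := pt_hasFDerivAt D K hK z (emin e)
  obtain ⟨A, hA, hA0, hAb⟩ := NN_hasFDerivAt (sub_ne_zero.2 he)
  have h1 : HasFDerivAt (fun z => D.pt K z (emax e) - D.pt K z (emin e)) (A1 - A2) z := hA1.sub hA2
  have h3 : HasFDerivAt (D.edgeDir K e) (A.comp (A1 - A2)) z :=
    HasFDerivAt.comp (g := NN) z hA h1
  rw [h3.fderiv]
  simp only [ContinuousLinearMap.comp_apply, sub_apply, hA1', hA2']
  exact edge_bound hC hτ h he hA0 hAb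

/-- translation: constant free displacement when there are no interval vertices -/
lemma edgeDir_trans (hK : Differentiable ℝ K) (z : D.Config) (e : Sym2 (Fin (2 * n)))
    (he : D.pt K z (emax e) ≠ D.pt K z (emin e)) (hno : ∀ v, ¬ D.IsIntervalVertex v) (u : E3) :
    fderiv ℝ (D.edgeDir K e) z (toConf D (fun _ => u)) = 0 := by
  obtain ⟨A1, hA1, hA1'⟩ := pt_hasFDerivAt D K hK z (emax e)
  obtain ⟨A2, hA2, hA2'⟩ := pt_hasFDerivAt D K hK z (emin e)
  obtain ⟨A, hA, hA0, hAb⟩ := NN_hasFDerivAt (sub_ne_zero.2 he)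
  have h1 : HasFDerivAt (fun z => D.pt K z (emax e) - D.pt K z (emin e)) (A1 - A2) z := hA1.sub hA2
  have h3 : HasFDerivAt (D.edgeDir K e) (A.comp (A1 - A2)) z :=
    HasFDerivAt.comp (g := NN) z hA h1
  rw [h3.fderiv]
  simp only [ContinuousLinearMap.comp_apply, sub_apply, hA1', hA2']
  simp [disp, hno]

end diag

end CSI

namespace CSI

lemma prod_pairs (m : ℕ) (f : Fin (2 * m) → ℝ) :
    ∏ t : Fin m, (f ⟨2 * (t : ℕ), by have := t.isLt; omega⟩ *
      f ⟨2 * (t : ℕ) + 1, by have := t.isLt; omega⟩) = ∏ i, f i := by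
  have key : ∀ (g : ℕ → ℝ) (m : ℕ), ∏ t ∈ Finset.range m, (g (2 * t) * g (2 * t + 1)) =
      ∏ i ∈ Finset.range (2 * m), g i := by
    intro g m
    induction m with
    | zero => simp
    | succ k ih =>
      rw [Finset.prod_range_succ, ih, show 2 * (k + 1) = 2 * k + 1 + 1 by ring,
        Finset.prod_range_succ, Finset.prod_range_succ]
      ring
  have := key (fun i => if h : i < 2 * m then f ⟨i, h⟩ else 1) m
  rw [← Fin.prod_univ_eq_prod_range (fun t => (fun i => if h : i < 2 * m then f ⟨i, h⟩ else 1) (2 * t) *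
    (fun i => if h : i < 2 * m then f ⟨i, h⟩ else 1) (2 * t + 1)),
    ← Fin.prod_univ_eq_prod_range (fun i => if h : i < 2 * m then f ⟨i, h⟩ else 1)] at this
  simp only [Fin.is_lt, dif_pos, Fin.eta] at this
  rw [← this]
  apply Finset.prod_congr rfl
  intro t _
  have := t.isLt
  rw [dif_pos (by omega), dif_pos (by omega)]

lemma abs_det3_le (u v w : E3) : |det3 u v w| ≤ 6 * (‖u‖ * ‖v‖ * ‖w‖) := by
  have key : ∀ (a b c : ℝ), |a| ≤ ‖u‖ → |b| ≤ ‖v‖ → |c| ≤ ‖w‖ → |a * b * c| ≤ ‖u‖ * ‖v‖ * ‖w‖ := by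
    intro a b c ha hb hc
    rw [abs_mul, abs_mul]
    gcongr
  have hc : ∀ (x : E3) (i : Fin 3), |x i| ≤ ‖x‖ := fun x i => by
    simpa using PiLp.norm_apply_le x i
  have k := fun i j l => abs_le.1 (key (u i) (v j) (w l) (hc _ _) (hc _ _) (hc _ _))
  unfold det3
  rw [abs_le]
  constructor <;>
  linarith [(k 0 1 2).1, (k 0 1 2).2, (k 0 2 1).1, (k 0 2 1).2, (k 1 0 2).1, (k 1 0 2).2,
    (k 1 2 0).1, (k 1 2 0).2, (k 2 0 1).1, (k 2 0 1).2, (k 2 1 0).1, (k 2 1 0).2]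

lemma abs_sphereForm_le (u v w : E3) (hu : ‖u‖ ≤ 1) : |sphereForm u v w| ≤ ‖v‖ * ‖w‖ := by
  unfold sphereForm
  have hpi := Real.pi_gt_three
  rw [abs_div, abs_of_pos (by positivity : 0 < 4 * Real.pi), div_le_iff₀ (by positivity)]
  refine (abs_det3_le u v w).trans ?_
  have h0 : 0 ≤ ‖v‖ * ‖w‖ := by positivity
  have : ‖u‖ * ‖v‖ * ‖w‖ ≤ ‖v‖ * ‖w‖ := by nlinarith
  nlinarith

lemma wedge_bound {E : Type*} (m : ℕ) (α : Fin m → E → E → ℝ) (N : Fin m → E → ℝ)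
    (hα : ∀ t v w, |α t v w| ≤ N t v * N t w) (v : Fin (2 * m) → E)
    (τ : Fin (2 * m) → ℝ) (T : Fin m → ℝ) (hT : ∀ t, 0 < T t) (hN0 : ∀ t v, 0 ≤ N t v)
    (hN : ∀ t i, N t (v i) ≤ τ i / T t) :
    |wedgeEval m α v| ≤ (Nat.factorial (2 * m) : ℝ) * ((∏ i, τ i) / ∏ t, (T t) ^ 2) := by
  unfold wedgeEval
  have hterm : ∀ σ : Equiv.Perm (Fin (2 * m)), |((Equiv.Perm.sign σ : ℤ) : ℝ) *
      ∏ t : Fin m,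
        α t (v (σ ⟨2 * (t : ℕ), by have := t.isLt; omega⟩))
            (v (σ ⟨2 * (t : ℕ) + 1, by have := t.isLt; omega⟩))| ≤ (∏ i, τ i) / ∏ t, (T t) ^ 2 := by
    intro σ
    rw [abs_mul]
    have : |((Equiv.Perm.sign σ : ℤ) : ℝ)| = 1 := by
      rcases Int.units_eq_one_or (Equiv.Perm.sign σ) with h | h <;> simp [h]
    rw [this, one_mul, Finset.abs_prod]
    calc _ ≤ ∏ t : Fin m, ((τ (σ ⟨2 * (t : ℕ), by have := t.isLt; omega⟩) *
            τ (σ ⟨2 * (t : ℕ) + 1, by have := t.isLt; omega⟩)) / T t ^ 2) := by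
          apply Finset.prod_le_prod
          · intros; exact abs_nonneg _
          · intro t _
            refine (hα _ _ _).trans ?_
            calc _ ≤ _ := mul_le_mul (hN t _) (hN t _) (hN0 _ _) ((hN0 _ _).trans (hN t _))
              _ = _ := by have := hT t; field_simp
      _ = _ := by
          rw [Finset.prod_div_distrib, prod_pairs m (fun i => τ (σ i)), Equiv.prod_comp σ τ]
  rw [abs_div, abs_of_pos (by positivity : (0:ℝ) < 2 ^ m)]
  have hs : |∑ σ : Equiv.Perm (Fin (2 * m)), ((Equiv.Perm.sign σ : ℤ) : ℝ) *
      ∏ t : Fin m,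
        α t (v (σ ⟨2 * (t : ℕ), by have := t.isLt; omega⟩))
            (v (σ ⟨2 * (t : ℕ) + 1, by have := t.isLt; omega⟩))| ≤
            (Nat.factorial (2 * m) : ℝ) * ((∏ i, τ i) / ∏ t, (T t) ^ 2) := by
    refine (Finset.abs_sum_le_sum_abs _ _).trans ((Finset.sum_le_sum fun σ _ => hterm σ).trans ?_)
    rw [Finset.sum_const, nsmul_eq_mul, Finset.card_univ, Fintype.card_perm, Fintype.card_fin]
  rw [div_le_iff₀ (by positivity)]
  have h0 := (abs_nonneg _).trans hs
  have : (1:ℝ) ≤ 2 ^ m := one_le_pow₀ (by norm_num)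
  exact hs.trans (by nlinarith)

section alt
variable {E : Type*} [AddCommGroup E] [Module ℝ E]

noncomputable def pairMul (m : ℕ) (α : Fin m → E → E → ℝ)
    (ha1 : ∀ t x y w, α t (x + y) w = α t x w + α t y w)
    (ha2 : ∀ t x y w, α t w (x + y) = α t w x + α t w y)
    (hs1 : ∀ t (r : ℝ) x w, α t (r • x) w = r * α t x w)
    (hs2 : ∀ t (r : ℝ) x w, α t w (r • x) = r * α t w x) :
    MultilinearMap ℝ (fun _ : Fin (2 * m) => E) ℝ :=
  have key : ∀ (v : Fin (2 * m) → E) (i : Fin (2 * m)), ∃ (t0 : Fin m) (f : E → ℝ),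
      (∀ x y, f (x + y) = f x + f y) ∧ (∀ (r : ℝ) x, f (r • x) = r * f x) ∧
      ∀ x, ∏ t : Fin m, α t (Function.update v i x ⟨2 * (t : ℕ), by have := t.isLt; omega⟩)
            (Function.update v i x ⟨2 * (t : ℕ) + 1, by have := t.isLt; omega⟩) =
        f x * ∏ t ∈ Finset.univ.erase t0, α t (v ⟨2 * (t : ℕ), by have := t.isLt; omega⟩)
            (v ⟨2 * (t : ℕ) + 1, by have := t.isLt; omega⟩) := by
    intro v i
    have hi := i.isLt
    have hrest : ∀ (t0 : Fin m) (x : E), (i : ℕ) = 2 * t0 ∨ (i : ℕ) = 2 * t0 + 1 →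
        ∏ t ∈ Finset.univ.erase t0, α t (Function.update v i x ⟨2 * (t : ℕ), by have := t.isLt; omega⟩)
            (Function.update v i x ⟨2 * (t : ℕ) + 1, by have := t.isLt; omega⟩) =
        ∏ t ∈ Finset.univ.erase t0, α t (v ⟨2 * (t : ℕ), by have := t.isLt; omega⟩)
            (v ⟨2 * (t : ℕ) + 1, by have := t.isLt; omega⟩) := by
      intro t0 x h0
      apply Finset.prod_congr rfl
      intro t ht
      have hne : (t : ℕ) ≠ t0 := fun h => (Finset.ne_of_mem_erase ht) (Fin.ext h)
      rw [Function.update_of_ne, Function.update_of_ne]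
      · intro h; have := congrArg Fin.val h; simp only at this; omega
      · intro h; have := congrArg Fin.val h; simp only at this; omega
    rcases Nat.even_or_odd' (i : ℕ) with ⟨c, hc | hc⟩
    · have hcm : c < m := by omega
      refine ⟨⟨c, hcm⟩, fun x => α ⟨c, hcm⟩ x (v ⟨2 * c + 1, by omega⟩), fun x y => ha1 _ _ _ _,
        fun r x => hs1 _ _ _ _, fun x => ?_⟩
      rw [← Finset.mul_prod_erase _ _ (Finset.mem_univ (⟨c, hcm⟩ : Fin m)), hrest _ _ (Or.inl hc)]
      congr 2
      · have : (⟨2 * c, by omega⟩ : Fin (2 * m)) = i := Fin.ext hc.symm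
        simp only
        rw [this, Function.update_self]
      · rw [Function.update_of_ne]
        intro h; have := congrArg Fin.val h; simp only at this; omega
    · have hcm : c < m := by omega
      refine ⟨⟨c, hcm⟩, fun x => α ⟨c, hcm⟩ (v ⟨2 * c, by omega⟩) x, fun x y => ha2 _ _ _ _,
        fun r x => hs2 _ _ _ _, fun x => ?_⟩
      rw [← Finset.mul_prod_erase _ _ (Finset.mem_univ (⟨c, hcm⟩ : Fin m)), hrest _ _ (Or.inr hc)]
      congr 2
      · rw [Function.update_of_ne]
        intro h; have := congrArg Fin.val h; simp only at this; omega
      · have : (⟨2 * c + 1, by omega⟩ : Fin (2 * m)) = i := Fin.ext hc.symm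
        simp only
        rw [this, Function.update_self]
  { toFun := fun v => ∏ t : Fin m, α t (v ⟨2 * (t : ℕ), by have := t.isLt; omega⟩)
            (v ⟨2 * (t : ℕ) + 1, by have := t.isLt; omega⟩)
    map_update_add' := by
      intro inst v i x y
      obtain ⟨t0, f, hf1, hf2, hf⟩ := key v i
      have e : inst = instDecidableEqFin (2 * m) := Subsingleton.elim _ _
      subst e
      rw [hf, hf, hf, hf1]; ring
    map_update_smul' := by
      intro inst v i r x
      obtain ⟨t0, f, hf1, hf2, hf⟩ := key v i
      have e : inst = instDecidableEqFin (2 * m) := Subsingleton.elim _ _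
      subst e
      rw [hf, hf, hf2, smul_eq_mul]; ring }

lemma wedge_det (m : ℕ) (α : Fin m → E → E → ℝ)
    (ha1 : ∀ t x y w, α t (x + y) w = α t x w + α t y w)
    (ha2 : ∀ t x y w, α t w (x + y) = α t w x + α t w y)
    (hs1 : ∀ t (r : ℝ) x w, α t (r • x) w = r * α t x w)
    (hs2 : ∀ t (r : ℝ) x w, α t w (r • x) = r * α t w x)
    (e : Fin (2 * m) → E) (M : Matrix (Fin (2 * m)) (Fin (2 * m)) ℝ) :
    wedgeEval m α (fun i => ∑ j, M i j • e j) = M.det * wedgeEval m α e := by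
  set G := MultilinearMap.alternatization (pairMul m α ha1 ha2 hs1 hs2) with hG
  have hw : ∀ v, wedgeEval m α v = G v / 2 ^ m := by
    intro v
    rw [hG, MultilinearMap.alternatization_apply]
    unfold wedgeEval
    congr 1
    apply Finset.sum_congr rfl
    intro σ _
    rw [MultilinearMap.domDomCongr_apply]
    simp only [pairMul, MultilinearMap.coe_mk]
    rw [Units.smul_def, zsmul_eq_mul]
  set G' := G.compLinearMap (Fintype.linearCombination ℝ e) with hG'
  have h1 := AlternatingMap.eq_smul_basis_det (Pi.basisFun ℝ (Fin (2 * m))) G'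
  have h2 : G' (fun i j => M i j) = G' (Pi.basisFun ℝ (Fin (2 * m))) * M.det := by
    conv_lhs => rw [h1]
    rw [AlternatingMap.smul_apply, Pi.basisFun_det, smul_eq_mul]
    rfl
  have h3 : G' (fun i j => M i j) = G (fun i => ∑ j, M i j • e j) := by
    rw [hG', AlternatingMap.compLinearMap_apply]
    rfl
  have h4 : G' (Pi.basisFun ℝ (Fin (2 * m))) = G e := by
    rw [hG', AlternatingMap.compLinearMap_apply]
    congr 1
    funext i
    simp [Fintype.linearCombination_apply, Pi.single_apply]
  rw [hw, hw, ← h3, h2, h4]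
  ring

end alt
end CSI

namespace CSI

lemma det_blocks {V ι : Type*} [Fintype V] [DecidableEq V] [Fintype ι] [DecidableEq ι] (l : List V) (hnd : l.Nodup) (hmem : ∀ v, v ∈ l)
    (M : Matrix ι ι ℝ) (b : ι → V)
    (hz : l.Pairwise (fun u v => ∀ i j, b i = u → b j = v → M i j = 0)) :
    M.det = ∏ v : V, (M.toSquareBlock b v).det := by
  have hinj : Function.Injective (fun v : V => OrderDual.toDual (l.idxOf v)) := by
    intro u v h
    have h' : l.idxOf u = l.idxOf v := h
    exact (List.idxOf_inj (hmem u)).1 h'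
  letI : LinearOrder V := LinearOrder.lift' (fun v : V => OrderDual.toDual (l.idxOf v)) hinj
  have hb : M.BlockTriangular b := by
    intro i j hij
    have hij0 : (fun v : V => OrderDual.toDual (l.idxOf v)) (b j) <
      (fun v : V => OrderDual.toDual (l.idxOf v)) (b i) := hij
    have hij' : l.idxOf (b i) < l.idxOf (b j) := OrderDual.toDual_lt_toDual.1 hij0
    have := List.pairwise_iff_getElem.1 hz (l.idxOf (b i)) (l.idxOf (b j))
      (List.idxOf_lt_length_of_mem (hmem _)) (List.idxOf_lt_length_of_mem (hmem _)) hij'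
    rw [List.getElem_idxOf, List.getElem_idxOf] at this
    exact this i j rfl rfl
  have := hb.det_fintype
  convert this

section diag
variable {n : ℕ} (D : Diagram n)

def vtx : D.BasisIndex → Fin (2 * n)
  | Sum.inl v => v
  | Sum.inr (v, _) => v

def cidx : D.BasisIndex → Fin 3
  | Sum.inl _ => 0
  | Sum.inr (_, j) => j

def entry (d : Fin (2 * n) → E3) (s : D.BasisIndex) : ℝ := d (vtx D s) (cidx D s)

lemma toConf_eq (d : Fin (2 * n) → E3) :
    toConf D d = ∑ s : D.BasisIndex, entry D d s • D.basisVec s := by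
  rw [Fintype.sum_sum_type, Fintype.sum_prod_type]
  simp only [Diagram.basisVec, entry, vtx, cidx]
  refine Prod.ext ?_ ?_
  · funext v
    simp [toConf, Prod.fst_sum, Finset.sum_apply, Pi.single_apply]
  · funext v
    simp only [toConf, Prod.snd_add, Prod.snd_sum, Prod.smul_mk, smul_zero, Finset.sum_const_zero, zero_add]
    rw [Finset.sum_apply, Finset.sum_eq_single v]
    · ext k
      simp [Finset.sum_apply, Pi.single_apply]
    · intro u _ huv
      simp [Finset.sum_apply, Pi.single_apply, huv.symm]
    · simp

noncomputable def RM (R : D.BasisIndex → Fin (2 * n) → E3) : Matrix D.BasisIndex D.BasisIndex ℝ :=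
  Matrix.of fun r s => entry D (R r) s

noncomputable def MM (c : Fin (2 * n) → Fin 3 → Fin (2 * n) → E3) : Matrix D.BasisIndex D.BasisIndex ℝ :=
  RM D (fun r => c (vtx D r) (cidx D r))

lemma abs_det_MM (c : Fin (2 * n) → Fin 3 → Fin (2 * n) → E3) (l : List (Fin (2 * n)))
    (hnd : l.Nodup) (hmem : ∀ v, v ∈ l) (hz : l.Pairwise (fun u v => ∀ j, c u j v = 0)) :
    |(MM D c).det| = ∏ v, blk D.IsIntervalVertex c v := by
  rw [det_blocks l hnd hmem (MM D c) (vtx D) (hz.imp ?_), Finset.abs_prod]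
  · apply Finset.prod_congr rfl
    intro v _
    unfold blk
    split_ifs with h
    · let f : Unit → {r // vtx D r = v} := fun _ => ⟨Sum.inl ⟨v, h⟩, rfl⟩
      have hf : Function.Bijective f := by
        refine ⟨fun _ _ _ => rfl, ?_⟩
        rintro ⟨r | ⟨r, j⟩, hr⟩
        · refine ⟨(), ?_⟩
          apply Subtype.ext
          simp only [f, Sum.inl.injEq]
          exact Subtype.ext hr.symm
        · have hr' : (r : Fin (2 * n)) = v := hr
          exact absurd (hr' ▸ h) r.2
      rw [← Matrix.det_submatrix_equiv_self (Equiv.ofBijective f hf), Matrix.det_unique]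
      rfl
    · let f : Fin 3 → {r // vtx D r = v} := fun j => ⟨Sum.inr (⟨v, h⟩, j), rfl⟩
      have hf : Function.Bijective f := by
        refine ⟨fun i j hij => ?_, ?_⟩
        · have h2 := congrArg Subtype.val hij
          simpa [f] using h2
        rintro ⟨r | ⟨r, j⟩, hr⟩
        · have hr' : (r : Fin (2 * n)) = v := hr
          exact absurd (hr' ▸ r.2) h
        · refine ⟨j, ?_⟩
          apply Subtype.ext
          simp only [f, Sum.inr.injEq, Prod.mk.injEq, and_true]
          exact Subtype.ext hr.symm
      rw [← Matrix.det_submatrix_equiv_self (Equiv.ofBijective f hf)]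
      rfl
  · intro u v h i j hi hj
    show c (vtx D i) (cidx D i) (vtx D j) (cidx D j) = 0
    rw [hi, hj, h]; rfl

lemma pt_ne {K : ℝ → E3} {z : D.Config} (hz : z ∈ D.csDomain K) {e : Sym2 (Fin (2 * n))} (he : e ∈ D.edges) :
    D.pt K z (emax e) ≠ D.pt K z (emin e) := by
  induction e using Sym2.ind with
  | _ a b =>
    have h1 := hz.2.2 _ he a b rfl
    have h2 : emax s(a, b) = a ⊔ b := rfl
    have h3 : emin s(a, b) = a ⊓ b := rfl
    rw [h2, h3]
    rcases le_total a b with h | h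
    · rw [sup_eq_right.2 h, inf_eq_left.2 h]; exact h1.symm
    · rw [sup_eq_left.2 h, inf_eq_right.2 h]; exact h1

lemma norm_edgeDir_le (K : ℝ → E3) (e : Sym2 (Fin (2 * n))) (z : D.Config) : ‖D.edgeDir K e z‖ ≤ 1 := by
  unfold Diagram.edgeDir
  rw [norm_smul, norm_inv, norm_norm]
  exact inv_mul_le_one

lemma sf_add1 (u x y w : E3) : sphereForm u (x + y) w = sphereForm u x w + sphereForm u y w := by
  unfold sphereForm det3; simp; ring
lemma sf_add2 (u x y w : E3) : sphereForm u w (x + y) = sphereForm u w x + sphereForm u w y := by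
  unfold sphereForm det3; simp; ring
lemma sf_smul1 (u x w : E3) (r : ℝ) : sphereForm u (r • x) w = r * sphereForm u x w := by
  unfold sphereForm det3; simp; ring
lemma sf_smul2 (u x w : E3) (r : ℝ) : sphereForm u w (r • x) = r * sphereForm u w x := by
  unfold sphereForm det3; simp; ring

/-- change of basis estimate for the integrand -/
lemma integrand_bound (K : ℝ → E3) (L : List (Sym2 (Fin (2 * n)))) (ord : Fin (2 * L.length) ≃ D.BasisIndex)
    (z : D.Config) (R : D.BasisIndex → Fin (2 * n) → E3) (τ : D.BasisIndex → ℝ)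
    (T : Fin L.length → ℝ) (hT : ∀ t, 0 < T t)
    (hR : ∀ t r, ‖fderiv ℝ (D.edgeDir K (L.get t)) z (toConf D (R r))‖ ≤ τ r / T t) :
    |(RM D R).det| *
      |D.csIntegrand K L ord z| ≤
      (Nat.factorial (2 * L.length) : ℝ) * ((∏ r, τ r) / ∏ t, (T t) ^ 2) := by
  have h1 := wedge_det L.length (fun t => D.edgeForm K (L.get t) z)
    (fun t x y w => by simp only [Diagram.edgeForm, map_add, sf_add1])
    (fun t x y w => by simp only [Diagram.edgeForm, map_add, sf_add2])
    (fun t r x w => by simp only [Diagram.edgeForm, map_smul, sf_smul1])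
    (fun t r x w => by simp only [Diagram.edgeForm, map_smul, sf_smul2])
    (fun i => D.basisVec (ord i))
    (Matrix.submatrix (RM D R) ord ord)
  rw [Matrix.det_submatrix_equiv_self] at h1
  have h2 : ∀ i, (∑ j, (Matrix.submatrix (RM D R) ord ord) i j •
      D.basisVec (ord j)) = toConf D (R (ord i)) := by
    intro i
    rw [toConf_eq, ← Equiv.sum_comp ord]
    rfl
  simp only [h2] at h1
  unfold Diagram.csIntegrand
  rw [← abs_mul, ← h1, ← Equiv.prod_comp ord]
  apply wedge_bound (N := fun t w => ‖fderiv ℝ (D.edgeDir K (L.get t)) z w‖)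
  · intro t v w
    exact abs_sphereForm_le _ _ _ (norm_edgeDir_le D K _ z)
  · exact hT
  · intros; positivity
  · intro t i; exact hR t (ord i)

end diag
end CSI

namespace CSI

section graph
variable {n : ℕ} (D : Diagram n)

lemma edge_ends (e : Sym2 (Fin (2 * n))) : e = s(emin e, emax e) := by
  induction e using Sym2.ind with
  | _ a b =>
    have h2 : emax s(a, b) = a ⊔ b := rfl
    have h3 : emin s(a, b) = a ⊓ b := rfl
    rw [h2, h3]
    rcases le_total a b with h | h
    · rw [sup_eq_right.2 h, inf_eq_left.2 h]
    · rw [sup_eq_left.2 h, inf_eq_right.2 h, Sym2.eq_swap]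

lemma prod_degree (t : Fin (2 * n) → ℝ) (M : Multiset (Sym2 (Fin (2 * n)))) (hM : ∀ e ∈ M, ¬ e.IsDiag) :
    ∏ v, t v ^ (Multiset.card (M.filter fun e => v ∈ e)) =
      (M.map (fun e => t (emin e) * t (emax e))).prod := by
  induction M using Multiset.induction_on with
  | empty => simp
  | cons e M ih =>
    rw [Multiset.map_cons, Multiset.prod_cons, ← ih (fun e' he' => hM e' (Multiset.mem_cons_of_mem he'))]
    have h1 : t (emin e) * t (emax e) = ∏ v, t v ^ (if v ∈ e then 1 else 0) := by
      have hne : emin e ≠ emax e := by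
        intro h
        apply hM e (Multiset.mem_cons_self _ _)
        rw [edge_ends e, h]
        simp
      rw [← Finset.prod_pair hne]
      have h3 : ∀ v, t v ^ (if v ∈ e then 1 else 0) = if v ∈ ({emin e, emax e} : Finset (Fin (2 * n))) then t v else 1 := by
        intro v
        have : v ∈ e ↔ v ∈ ({emin e, emax e} : Finset (Fin (2 * n))) := by
          conv_lhs => rw [edge_ends e]
          simp
        by_cases h : v ∈ e
        · rw [if_pos h, if_pos (this.1 h), pow_one]
        · rw [if_neg h, if_neg (fun h' => h (this.2 h')), pow_zero]
      simp only [h3]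
      rw [Finset.prod_ite_mem, Finset.univ_inter]
    rw [h1, ← Finset.prod_mul_distrib]
    apply Finset.prod_congr rfl
    intro v _
    rw [← pow_add]
    congr 1
    rw [← Multiset.countP_eq_card_filter, ← Multiset.countP_eq_card_filter, Multiset.countP_cons, add_comm]

lemma prod_vtx (hD : D.IsTrivalent) (t : Fin (2 * n) → ℝ) :
    ∏ r, t (vtx D r) = (D.edges.map (fun e => t (emin e) * t (emax e))).prod := by
  rw [← prod_degree t _ hD.not_diag, Fintype.prod_sum_type, Fintype.prod_prod_type]
  simp only [vtx, Finset.prod_const, Finset.card_univ, Fintype.card_fin]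
  rw [← Fintype.prod_subtype_mul_prod_subtype (fun v => D.IsIntervalVertex v)]
  congr 1
  · apply Finset.prod_congr
    · ext; simp
    intro v _
    have := hD.degree_interval v.1 v.2
    unfold Diagram.degree at this
    rw [this, pow_one]
  · apply Finset.prod_congr
    · ext; simp
    intro v _
    have := hD.degree_free v.1 v.2
    unfold Diagram.degree at this
    rw [this]

noncomputable def qq (t : Fin (2 * n) → ℝ) (e : Sym2 (Fin (2 * n))) : ℝ :=
  t (emin e) * t (emax e) / (max (t (emax e)) (t (emin e))) ^ 2

noncomputable def rho (t : Fin (2 * n) → ℝ) : ℝ := (D.edges.map (qq t)).prod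

lemma qq_pos {t : Fin (2 * n) → ℝ} (ht : ∀ v, 1 ≤ t v) (e) : 0 < qq t e := by
  unfold qq
  have h1 := ht (emin e)
  have h2 := ht (emax e)
  have : 0 < max (t (emax e)) (t (emin e)) := lt_of_lt_of_le (by linarith) (le_max_left _ _)
  have h3 : 0 < t (emin e) * t (emax e) := by nlinarith
  positivity

lemma qq_mul_le {t : Fin (2 * n) → ℝ} (ht : ∀ v, 1 ≤ t v) (a b) : t b * qq t s(a, b) ≤ t a := by
  have key : ∀ x y : ℝ, 1 ≤ x → 1 ≤ y → y * (x * y / (max y x)^2) ≤ x := by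
    intro x y hx hy
    have h0 : 0 < max y x := lt_of_lt_of_le (by linarith) (le_max_left _ _)
    rw [mul_div_assoc', div_le_iff₀ (by positivity)]
    have := le_max_left y x
    have h2 : y ^ 2 ≤ (max y x) ^ 2 := by gcongr
    nlinarith
  have h2 : emax s(a, b) = a ⊔ b := rfl
  have h3 : emin s(a, b) = a ⊓ b := rfl
  unfold qq
  rw [h2, h3]
  rcases le_total a b with h | h
  · rw [sup_eq_right.2 h, inf_eq_left.2 h]; exact key _ _ (ht _) (ht _)
  · rw [sup_eq_left.2 h, inf_eq_right.2 h, max_comm, mul_comm (t b) (t a)]; exact key _ _ (ht _) (ht _)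

lemma qq_le_one {t : Fin (2 * n) → ℝ} (ht : ∀ v, 1 ≤ t v) (e) : qq t e ≤ 1 := by
  unfold qq
  have h1 := ht (emin e)
  have h2 := ht (emax e)
  have : 0 < max (t (emax e)) (t (emin e)) := lt_of_lt_of_le (by linarith) (le_max_left _ _)
  rw [div_le_one (by positivity), sq]
  exact mul_le_mul (le_max_right _ _) (le_max_left _ _) (by linarith) this.le

lemma mprod_pos {t : Fin (2 * n) → ℝ} (ht : ∀ v, 1 ≤ t v) (M : Multiset (Sym2 (Fin (2 * n)))) :
    0 < (M.map (qq t)).prod ∧ (M.map (qq t)).prod ≤ 1 := by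
  induction M using Multiset.induction_on with
  | empty => simp
  | cons e M ih =>
    rw [Multiset.map_cons, Multiset.prod_cons]
    exact ⟨mul_pos (qq_pos ht e) ih.1, mul_le_one₀ (qq_le_one ht e) ih.1.le ih.2⟩

lemma rho_le {t : Fin (2 * n) → ℝ} (ht : ∀ v, 1 ≤ t v) {e} (he : e ∈ D.edges) : rho D t ≤ qq t e := by
  obtain ⟨M, hM⟩ := Multiset.exists_cons_of_mem he
  unfold rho
  rw [hM, Multiset.map_cons, Multiset.prod_cons]
  exact mul_le_of_le_one_right (qq_pos ht e).le (mprod_pos ht M).2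

lemma gain1 (hD : D.IsTrivalent) {v0 : Fin (2 * n)} (hv0 : D.IsIntervalVertex v0) (v : Fin (2 * n)) :
    ∃ m : ℕ, ∀ (t : Fin (2 * n) → ℝ) (B : ℝ), (∀ v, 1 ≤ t v) → (∀ v, D.IsIntervalVertex v → t v ≤ B) →
      t v * rho D t ^ m ≤ B := by
  induction hD.connected v0 v with
  | refl => exact ⟨0, fun t B h1 h2 => by simpa using h2 _ hv0⟩
  | @tail a b _ hab ih =>
    obtain ⟨m, hm⟩ := ih
    rcases hab with h | ⟨i, j, -, h | h⟩
    · refine ⟨m + 1, fun t B h1 h2 => ?_⟩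
      have h3 := hm t B h1 h2
      have h4 := qq_mul_le h1 a b
      have h5 := rho_le D h1 h
      have h6 : 0 < rho D t := (mprod_pos h1 D.edges).1
      calc t b * rho D t ^ (m + 1) = (t b * rho D t) * rho D t ^ m := by ring
        _ ≤ t a * rho D t ^ m := by
          gcongr
          have := h1 b
          exact (mul_le_mul_of_nonneg_left h5 (by linarith)).trans h4
        _ ≤ _ := h3
    · exact ⟨0, fun t B h1 h2 => by simpa using h2 _ ⟨j, h.2⟩⟩
    · exact ⟨0, fun t B h1 h2 => by simpa using h2 _ ⟨i, h.1⟩⟩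

lemma gain (hD : D.IsTrivalent) {v0 : Fin (2 * n)} (hv0 : D.IsIntervalVertex v0) :
    ∃ ε : ℝ, 0 < ε ∧ ∀ (t : Fin (2 * n) → ℝ) (B : ℝ), 1 ≤ B → (∀ v, 1 ≤ t v) →
      (∀ v, D.IsIntervalVertex v → t v ≤ B) →
      rho D t * ∏ v, t v ^ ε ≤ B ^ (2 * n) := by
  choose m hm using fun v => gain1 D hD hv0 v
  set N : ℕ := (∑ v, m v) + 1 with hN
  refine ⟨1 / N, by positivity, fun t B hB h1 h2 => ?_⟩
  have hr := mprod_pos h1 D.edges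
  change 0 < rho D t ∧ rho D t ≤ 1 at hr
  have hp : ∀ v, 0 ≤ t v := fun v => by linarith [h1 v]
  have e1 : (rho D t * ∏ v, t v ^ (1 / N : ℝ)) ^ N = rho D t * ∏ v, (t v * rho D t ^ m v) := by
    rw [mul_pow, ← Finset.prod_pow, Finset.prod_mul_distrib, Finset.prod_pow_eq_pow_sum, hN, pow_succ]
    have : ∀ v, (t v ^ (1 / ((∑ v, m v + 1 : ℕ) : ℝ))) ^ (∑ v, m v + 1) = t v := by
      intro v
      rw [one_div, Real.rpow_inv_natCast_pow (hp v) (by omega)]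
    simp only [this]
    ring
  have e2 : (rho D t * ∏ v, t v ^ (1 / N : ℝ)) ^ N ≤ B ^ (2 * n) := by
    rw [e1]
    have : ∏ v, (t v * rho D t ^ m v) ≤ ∏ _v : Fin (2 * n), B :=
      Finset.prod_le_prod (fun v _ => mul_nonneg (hp v) (pow_nonneg hr.1.le _)) (fun v _ => hm v t B h1 h2)
    rw [Finset.prod_const, Finset.card_univ, Fintype.card_fin] at this
    calc _ ≤ 1 * B ^ (2 * n) := by
          refine mul_le_mul hr.2 this ?_ zero_le_one
          exact Finset.prod_nonneg (fun v _ => mul_nonneg (hp v) (pow_nonneg hr.1.le _))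
      _ = _ := one_mul _
  have e3 : B ^ (2 * n) ≤ (B ^ (2 * n)) ^ N := le_self_pow₀ (one_le_pow₀ hB) (by omega)
  exact le_of_pow_le_pow_left₀ (by omega : N ≠ 0) (by positivity) (e2.trans e3)

end graph

lemma rnear_nonneg {V : Type*} (P : V → E3) (b : V) (l : List V) : 0 ≤ rnear P b l :=
  le_rnear P b l (by linarith [tt_ge_one P b]) (fun _ _ _ => norm_nonneg _)

lemma phi_nonneg {V : Type*} (isK : V → Prop) (ε : ℝ) (P : V → E3) (a : V) (o : Option V) (l : List V) :
    0 ≤ phi isK ε P a o l := by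
  cases o with
  | none =>
    unfold phi; split_ifs
    · exact zero_le_one
    · exact Real.rpow_nonneg (by linarith [tt_ge_one P a]) _
  | some b =>
    have := rnear_nonneg P b l
    unfold phi; split_ifs <;> positivity

lemma FF_nonneg {V : Type*} (isK : V → Prop) (ε : ℝ) (l : List (V × Option V)) (P : V → E3) :
    0 ≤ FF isK ε l P := by
  induction l with
  | nil => simp [FF]
  | cons a l ih => exact mul_nonneg (phi_nonneg _ _ _ _ _ _) ih

lemma WF.nodup {V : Type*} {l : List (V × Option V)} (h : WF l) : (l.map Prod.fst).Nodup := by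
  induction l with
  | nil => simp
  | cons a l ih =>
    rw [List.map_cons, List.nodup_cons]
    exact ⟨h.1, ih h.2.2⟩

/-- The pointwise estimate. -/
lemma pointwise {n : ℕ} (D : Diagram n) (hD : D.IsTrivalent) (K : ℝ → E3) (hK : IsKnot K)
    (L : List (Sym2 (Fin (2 * n)))) (hL : (L : Multiset (Sym2 (Fin (2 * n)))) = D.edges)
    (ord : Fin (2 * L.length) ≃ D.BasisIndex) {v0 : Fin (2 * n)} (hv0 : D.IsIntervalVertex v0) :
    ∃ ε : ℝ, 0 < ε ∧ ∃ C : ℝ, 0 ≤ C ∧ ∀ z ∈ D.csDomain K, Function.Injective (D.pt K z) →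
      ∃ l : List (Fin (2 * n) × Option (Fin (2 * n))), WF l ∧ l.length = 2 * n ∧ (∀ v, v ∈ l.map Prod.fst) ∧
        |D.csIntegrand K L ord z| ≤ C * FF D.IsIntervalVertex ε l (D.pt K z) := by
  obtain ⟨B0, hB0⟩ := exists_KC hK
  obtain ⟨ε, hε, hgain⟩ := gain D hD hv0
  set B := B0 ^ 3 with hB
  set C0 : ℝ := (2 * B ^ 3 + 4) ^ (2 * n) with hC0
  have hB1 : 1 ≤ B := one_le_pow₀ hB0.one_le
  have hC1 : 1 ≤ C0 := one_le_pow₀ (by nlinarith [one_le_pow₀ hB1 (n := 3)])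
  have hKd : Differentiable ℝ K := hK.smooth.differentiable (by simp)
  refine ⟨ε, hε, B ^ (2 * n) * ((Nat.factorial (2 * L.length) : ℝ) * (4 * C0 ^ 2) ^ (2 * L.length)) * B ^ (2 * n),
    by positivity, fun z hz hinj => ?_⟩
  set P := D.pt K z with hP
  have hiv : ∀ v (h : D.IsIntervalVertex v), z.1 ⟨v, h⟩ ∈ Set.Icc (0:ℝ) 1 := by
    rintro v ⟨i, rfl⟩
    exact ⟨(hz.1 i).1.le, (hz.1 i).2.le⟩
  have hT : TData D.IsIntervalVertex B P (TT D K z) := by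
    refine KC.TData hK.periodic hB0 (x := fun v => if h : D.IsIntervalVertex v then z.1 ⟨v, h⟩ else 0) ?_ ?_ ?_
    · intro v hv; rw [dif_pos hv]; exact hiv v hv
    · intro v hv; rw [dif_pos hv, hP, Diagram.pt, dif_pos hv]
    · intro v hv; rw [dif_pos hv, TT, dif_pos hv]
  obtain ⟨l, c, lam, hwf, hmem, hgood, hpw, hone⟩ := rows_exist hT hε.le hinj (2 * n) Finset.univ
    (by simp) 0 (fun i _ => by linarith [tt_ge_one P i]) (fun i _ l _ _ => norm_nonneg _)
  have hmem' : ∀ v, v ∈ l.map Prod.fst := fun v => (hmem v).2 (Finset.mem_univ _)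
  have hnd := hwf.nodup
  refine ⟨l, hwf, ?_, hmem', ?_⟩
  · have : (l.map Prod.fst).toFinset = Finset.univ := by ext v; simp only [List.mem_toFinset, hmem', Finset.mem_univ]
    have h2 := List.toFinset_card_of_nodup hnd
    rw [this, Finset.card_univ, Fintype.card_fin, List.length_map] at h2
    exact h2.symm
  have ht1 : ∀ v, 1 ≤ tt P v := tt_ge_one P
  have hb := integrand_bound D K L ord z (fun r => c (vtx D r) (cidx D r))
    (fun r => 4 * C0 ^ 2 * tt P (vtx D r)) (fun t => max (tt P (emax (L.get t))) (tt P (emin (L.get t))))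
    (fun t => lt_of_lt_of_le (by linarith [ht1 (emax (L.get t))]) (le_max_left _ _))
    (fun t r => by
      have he : L.get t ∈ D.edges := by rw [← hL]; exact List.get_mem _ _
      have := edgeDir_bound D K hKd z (L.get t) (pt_ne D hz he) hC1 (by linarith [ht1 (vtx D r)])
        (hgood (vtx D r) (Finset.mem_univ _) (cidx D r))
      rw [mul_div_assoc]; exact this)
  have hdet := abs_det_MM D c (l.map Prod.fst) hnd hmem' hpw
  unfold MM at hdet
  rw [hdet] at hb
  have hrho : (∏ r, 4 * C0 ^ 2 * tt P (vtx D r)) /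
      ∏ t : Fin L.length, (max (tt P (emax (L.get t))) (tt P (emin (L.get t)))) ^ 2 =
      (4 * C0 ^ 2) ^ (2 * L.length) * rho D (tt P) := by
    rw [Finset.prod_mul_distrib, Finset.prod_const, Finset.card_univ, ← Fintype.card_congr ord, Fintype.card_fin,
      prod_vtx D hD, mul_div_assoc]
    congr 1
    unfold rho
    rw [← hL, Multiset.map_coe, Multiset.prod_coe, Multiset.map_coe, Multiset.prod_coe]
    have : ∀ f : Sym2 (Fin (2 * n)) → ℝ, (L.map f).prod = ∏ t : Fin L.length, f (L.get t) := by
      intro f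
      conv_lhs => rw [← List.ofFn_get L, List.map_ofFn, List.prod_ofFn]
      rfl
    rw [this, this, ← Finset.prod_div_distrib]
    rfl
  rw [hrho] at hb
  have hg := hgain (tt P) B hB1 ht1 hT.tt_le
  rw [Finset.prod_mul_distrib, Finset.card_univ, Fintype.card_fin] at hone
  have hF := FF_nonneg D.IsIntervalVertex ε l P
  have hf0 := abs_nonneg (D.csIntegrand K L ord z)
  have hte : 0 ≤ ∏ v, tt P v ^ ε := Finset.prod_nonneg (fun v _ => Real.rpow_nonneg (by linarith [ht1 v]) _)
  calc |D.csIntegrand K L ord z| ≤ |D.csIntegrand K L ord z| *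
        (B ^ (2 * n) * ((∏ v, blk D.IsIntervalVertex c v) * ∏ v, tt P v ^ ε) * FF D.IsIntervalVertex ε l P) :=
        le_mul_of_one_le_right hf0 hone
    _ = B ^ (2 * n) * ((∏ v, blk D.IsIntervalVertex c v) * |D.csIntegrand K L ord z|) *
        (∏ v, tt P v ^ ε) * FF D.IsIntervalVertex ε l P := by ring
    _ ≤ B ^ (2 * n) * ((Nat.factorial (2 * L.length) : ℝ) * ((4 * C0 ^ 2) ^ (2 * L.length) * rho D (tt P))) *
        (∏ v, tt P v ^ ε) * FF D.IsIntervalVertex ε l P := by gcongr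
    _ = B ^ (2 * n) * ((Nat.factorial (2 * L.length) : ℝ) * (4 * C0 ^ 2) ^ (2 * L.length)) *
        (rho D (tt P) * ∏ v, tt P v ^ ε) * FF D.IsIntervalVertex ε l P := by ring
    _ ≤ _ := by gcongr

end CSI

namespace CSI

lemma integrand_zero {n : ℕ} (D : Diagram n) (K : ℝ → E3) (hK : IsKnot K)
    (L : List (Sym2 (Fin (2 * n)))) (hL : (L : Multiset (Sym2 (Fin (2 * n)))) = D.edges)
    (ord : Fin (2 * L.length) ≃ D.BasisIndex) (hno : ∀ v, ¬ D.IsIntervalVertex v) (v0 : Fin (2 * n))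
    (z : D.Config) (hz : z ∈ D.csDomain K) : D.csIntegrand K L ord z = 0 := by
  have hKd : Differentiable ℝ K := hK.smooth.differentiable (by simp)
  let r0 : D.BasisIndex := Sum.inr (⟨v0, hno v0⟩, 0)
  let R : D.BasisIndex → Fin (2 * n) → E3 := fun r =>
    if r = r0 then fun _ => EuclideanSpace.single 0 1 else Pi.single (vtx D r) (EuclideanSpace.single (cidx D r) 1)
  have hdet : (RM D R).det = 1 := by
    have : RM D R = (1 : Matrix D.BasisIndex D.BasisIndex ℝ).updateRow r0
        (entry D (fun _ => EuclideanSpace.single 0 1)) := by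
      ext r s
      rw [Matrix.updateRow_apply]
      split_ifs with h
      · simp [RM, R, h]
      · simp only [RM, R, if_neg h, Matrix.of_apply, entry]
        rw [Matrix.one_apply]
        rcases r with r | ⟨r, i⟩
        · exact absurd r.2 (hno _)
        rcases s with s | ⟨s, j⟩
        · exact absurd s.2 (hno _)
        simp only [vtx, cidx]
        by_cases hrs : r = s
        · subst hrs
          simp [Pi.single_apply, eq_comm]
        · have : (s : Fin (2 * n)) ≠ r := fun h => hrs (Subtype.ext h.symm)
          rw [Pi.single_eq_of_ne this, if_neg]
          · rfl
          · simpa using fun h => absurd h hrs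
    rw [this, ← Matrix.cramer_transpose_apply, Matrix.transpose_one, Matrix.cramer_one]
    simp [entry, r0, cidx, vtx]
  have hb := integrand_bound D K L ord z R
    (fun r => if r = r0 then 0 else ∑ t, ‖fderiv ℝ (D.edgeDir K (L.get t)) z (toConf D (R r))‖) (fun _ => 1)
    (fun _ => one_pos) (fun t r => by
      rw [div_one]
      split_ifs with h
      · have he : L.get t ∈ D.edges := by rw [← hL]; exact List.get_mem _ _
        simp only [R, if_pos h]
        rw [edgeDir_trans D K hKd z _ (pt_ne D hz he) hno, norm_zero]
      · exact Finset.single_le_sum (f := fun t => ‖fderiv ℝ (D.edgeDir K (L.get t)) z (toConf D (R r))‖)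
          (fun _ _ => norm_nonneg _) (Finset.mem_univ t))
  have hp : (∏ r, (if r = r0 then (0:ℝ) else
      ∑ t, ‖fderiv ℝ (D.edgeDir K (L.get t)) z (toConf D (R r))‖)) = 0 :=
    Finset.prod_eq_zero (Finset.mem_univ r0) (if_pos rfl)
  rw [hdet, hp] at hb
  simp at hb
  exact hb

end CSI

namespace CSI

open MeasureTheory

/-- bound for the free vertex integral -/
lemma free_bound : ∃ A : ℝ, 0 ≤ A ∧ ∀ (b : E3) (r : ℝ),
    ∫⁻ p : E3, ENNReal.ofReal (if ‖p - b‖ ≤ r then (‖p - b‖ ^ 2 * r)⁻¹ else 0)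
      ≤ ENNReal.ofReal A := by
  refine ⟨3 * (volume : Measure E3).real (Metric.ball 0 1), by positivity, fun b r => ?_⟩
  have h1 := lintegral_sub_right_eq_self (μ := (volume : Measure E3))
    (fun p : E3 => ENNReal.ofReal (if ‖p‖ ≤ r then (‖p‖ ^ 2 * r)⁻¹ else 0)) b
  rw [h1]
  rcases le_or_gt r 0 with hr | hr
  · have : ∀ p : E3, (if ‖p‖ ≤ r then (‖p‖ ^ 2 * r)⁻¹ else 0) = 0 := by
      intro p
      split_ifs with h
      · have : r = 0 := le_antisymm hr ((norm_nonneg p).trans h)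
        simp [this]
      · rfl
    simp only [this]
    simp
  set f : ℝ → ℝ := fun y => if y ≤ r then (y ^ 2 * r)⁻¹ else 0 with hf
  have hdim : Module.finrank ℝ E3 = 3 := by simp
  have hEq : Set.EqOn (fun y : ℝ => y ^ (Module.finrank ℝ E3 - 1) • f y)
      ((Set.Ioc 0 r).indicator fun _ => r⁻¹) (Set.Ioi 0) := by
    intro y hy
    have hy0 : (0:ℝ) < y := hy
    rw [hdim]
    by_cases h : y ≤ r
    · simp only [hf, h, if_true, Set.indicator, Set.mem_Ioc, hy0, true_and, smul_eq_mul]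
      field_simp
    · simp [hf, h, Set.indicator]
  have hI0 : Integrable ((Set.Ioc 0 r).indicator fun _ => r⁻¹) (volume : Measure ℝ) := by
    rw [integrable_indicator_iff measurableSet_Ioc]
    exact integrableOn_const (by simp)
  have hfInt : Integrable (fun p : E3 => f ‖p‖) := by
    rw [integrable_fun_norm_addHaar (volume : Measure E3) (f := f),
      integrableOn_congr_fun hEq measurableSet_Ioi]
    exact hI0.integrableOn
  have hval : ∫ p : E3, f ‖p‖ = 3 * (volume : Measure E3).real (Metric.ball 0 1) := by
    rw [integral_fun_norm_addHaar, setIntegral_congr_fun measurableSet_Ioi hEq,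
      setIntegral_indicator measurableSet_Ioc, hdim]
    have : Set.Ioi (0:ℝ) ∩ Set.Ioc 0 r = Set.Ioc 0 r := by
      ext x; simp; 
    rw [this]
    simp [hr.le, hr.ne']
  rw [← hval, ofReal_integral_eq_lintegral_ofReal hfInt]
  refine Filter.Eventually.of_forall fun p => ?_
  simp only [hf, Pi.zero_apply]
  split_ifs
  · positivity
  · exact le_rfl

noncomputable def mK (K : ℝ → E3) : Measure E3 :=
  Measure.map K (volume.restrict (Set.Ioo (0:ℝ) 1))

lemma knot_bound {K : ℝ → E3} (hK : IsKnot K) : ∃ A : ℝ, 0 ≤ A ∧ ∀ (b : E3) (r : ℝ),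
    ∫⁻ p : E3, ENNReal.ofReal (if ‖p - b‖ ≤ r then r⁻¹ else 0) ∂(mK K)
      ≤ ENNReal.ofReal A := by
  obtain ⟨B, hB⟩ := exists_KC hK
  have hB1 := hB.one_le
  have hKm : Measurable K := hK.smooth.continuous.measurable
  refine ⟨12 * B, by positivity, fun b r => ?_⟩
  rcases le_or_gt r 0 with hr | hr
  · have : ∀ p : E3, (if ‖p - b‖ ≤ r then r⁻¹ else 0) = 0 := by
      intro p
      split_ifs with h
      · have : r = 0 := le_antisymm hr ((norm_nonneg _).trans h)
        simp [this]
      · rfl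
    simp [this]
  set S : Set E3 := {p | ‖p - b‖ ≤ r} with hS
  have hSm : MeasurableSet S := (isClosed_le (by fun_prop) (by fun_prop)).measurableSet
  have e1 : (fun p : E3 => ENNReal.ofReal (if ‖p - b‖ ≤ r then r⁻¹ else 0))
      = S.indicator fun _ => ENNReal.ofReal r⁻¹ := by
    ext p
    by_cases h : ‖p - b‖ ≤ r <;> simp [hS, Set.indicator, h]
  rw [e1, lintegral_indicator_const hSm]
  have key : mK K S ≤ ENNReal.ofReal (12 * B * r) := by
    rw [mK, Measure.map_apply hKm hSm, Measure.restrict_apply (hKm hSm)]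
    rcases (K ⁻¹' S ∩ Set.Ioo 0 1).eq_empty_or_nonempty with h | ⟨x0, hx0, hx0'⟩
    · rw [h]; simp
    have hsub : K ⁻¹' S ∩ Set.Ioo 0 1 ⊆ Metric.closedBall x0 (2 * B * r) ∪
        (Metric.closedBall (x0 + 1) (2 * B * r) ∪ Metric.closedBall (x0 - 1) (2 * B * r)) := by
      rintro x ⟨hx, hx'⟩
      have h1 := hB.low x ⟨hx'.1.le, hx'.2.le⟩ x0 ⟨hx0'.1.le, hx0'.2.le⟩
      have h2 : ‖K x - K x0‖ ≤ 2 * r := by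
        have hx1 : ‖K x - b‖ ≤ r := hx
        have hx2 : ‖K x0 - b‖ ≤ r := hx0
        calc ‖K x - K x0‖ = ‖(K x - b) - (K x0 - b)‖ := by congr 1; abel
          _ ≤ _ := (norm_sub_le _ _).trans (by linarith)
      have h3 : dd x x0 ≤ 2 * B * r := h1.trans (by nlinarith)
      obtain ⟨m, hm, hd⟩ := dd_cases x x0
      rw [hd] at h3
      rcases hm with rfl | rfl | rfl
      · left
        rw [Metric.mem_closedBall, Real.dist_eq]; simpa using h3
      · right; right
        rw [Metric.mem_closedBall, Real.dist_eq]
        convert h3 using 2; ring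
      · right; left
        rw [Metric.mem_closedBall, Real.dist_eq]
        convert h3 using 2; ring
    refine (measure_mono hsub).trans ((measure_union_le _ _).trans
      ((add_le_add le_rfl (measure_union_le _ _)).trans ?_))
    simp only [Real.volume_closedBall]
    rw [← ENNReal.ofReal_add (by positivity) (by positivity),
      ← ENNReal.ofReal_add (by positivity) (by positivity)]
    apply ENNReal.ofReal_le_ofReal
    linarith
  refine (mul_le_mul_right key _).trans ?_
  rw [← ENNReal.ofReal_mul (by positivity)]
  apply ENNReal.ofReal_le_ofReal
  apply le_of_eq
  field_simp

lemma mK_univ {K : ℝ → E3} (hK : IsKnot K) : mK K Set.univ = 1 := by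
  rw [mK, Measure.map_apply hK.smooth.continuous.measurable MeasurableSet.univ]
  simp

lemma mK_singleton {K : ℝ → E3} (hK : IsKnot K) (p : E3) : mK K {p} = 0 := by
  have hKm : Measurable K := hK.smooth.continuous.measurable
  rw [mK, Measure.map_apply hKm (measurableSet_singleton p),
    Measure.restrict_apply (hKm (measurableSet_singleton p))]
  apply Set.Subsingleton.measure_zero
  rintro x ⟨hx, hx'⟩ y ⟨hy, hy'⟩
  exact hK.injOn ⟨hx'.1.le, hx'.2⟩ ⟨hy'.1.le, hy'.2⟩ (hx.trans hy.symm)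

end CSI

namespace CSI

open MeasureTheory

variable {V : Type*}

lemma rnear_update (P : V → E3) (a b : V) (p : E3) (l : List V) (ha : a ∉ l) (hab : b ≠ a) :
    rnear (Function.update P a p) b l = rnear P b l := by
  induction l with
  | nil => simp [rnear, tt, hab]
  | cons v l ih =>
    simp only [List.mem_cons, not_or] at ha
    have hv : v ≠ a := fun h => ha.1 h.symm
    simp [rnear, ih ha.2, hab, hv]

lemma phi_update_ne (isK : V → Prop) (ε : ℝ) (P : V → E3) (a c : V) (p : E3) (o : Option V)
    (l : List V) (ha : a ∉ l) (hac : c ≠ a) (ho : ∀ b ∈ o, b ≠ a) :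
    phi isK ε (Function.update P a p) c o l = phi isK ε P c o l := by
  cases o with
  | none => simp [phi, tt, hac]
  | some b =>
    have hb : b ≠ a := ho b rfl
    simp only [phi, rnear_update P a b p l ha hb, Function.update_of_ne hb,
      Function.update_of_ne hac]

lemma FF_update (isK : V → Prop) (ε : ℝ) (P : V → E3) (a : V) (p : E3)
    (l : List (V × Option V)) (hl : WF l) (ha : a ∉ l.map Prod.fst) :
    FF isK ε l (Function.update P a p) = FF isK ε l P := by
  induction l with
  | nil => rfl
  | cons x l ih =>
    obtain ⟨c, o⟩ := x
    simp only [List.map_cons, List.mem_cons, not_or] at ha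
    obtain ⟨h1, h2, h3⟩ := hl
    simp only [FF]
    rw [ih h3 ha.2, phi_update_ne isK ε P a c p o _ ha.2 (fun h => ha.1 h.symm)
      (fun b hb h => ha.2 (h ▸ h2 b hb))]

lemma measurable_rnear [Fintype V] (b : V) (l : List V) :
    Measurable fun P : V → E3 => rnear P b l := by
  induction l with
  | nil => simp only [rnear, tt]; fun_prop
  | cons v l ih =>
    simp only [rnear]
    split_ifs
    · exact ih
    · exact Measurable.min (by fun_prop) ih

lemma measurable_phi [Fintype V] (isK : V → Prop) (ε : ℝ) (a : V) (o : Option V) (l : List V) :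
    Measurable fun P : V → E3 => phi isK ε P a o l := by
  cases o with
  | none =>
    simp only [phi, tt]
    split_ifs
    · exact measurable_const
    · fun_prop
  | some b =>
    have hr := measurable_rnear b l
    simp only [phi]
    refine Measurable.ite (measurableSet_le (by fun_prop) hr) ?_ measurable_const
    split_ifs
    · exact hr.inv
    · exact Measurable.inv (Measurable.mul (by fun_prop) hr)

lemma measurable_FF [Fintype V] (isK : V → Prop) (ε : ℝ) (l : List (V × Option V)) :
    Measurable fun P : V → E3 => FF isK ε l P := by
  induction l with
  | nil => simp only [FF]; exact measurable_const
  | cons x l ih =>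
    obtain ⟨c, o⟩ := x
    exact (measurable_phi isK ε c o _).mul ih

noncomputable def mu (isK : V → Prop) (K : ℝ → E3) (v : V) : Measure E3 :=
  if isK v then mK K else volume

instance mK_finite (K : ℝ → E3) : IsFiniteMeasure (mK K) := by
  unfold mK; infer_instance

instance mu_sigmaFinite (isK : V → Prop) (K : ℝ → E3) (v : V) : SigmaFinite (mu isK K v) := by
  unfold mu; split_ifs <;> infer_instance

lemma phi_int (isK : V → Prop) {K : ℝ → E3} (hK : IsKnot K) {ε : ℝ} (hε : 0 < ε) :
    ∃ A : ENNReal, A ≠ ⊤ ∧ ∀ (P : V → E3) (a : V) (o : Option V) (l : List V), a ∉ l →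
      (∀ b ∈ o, b ∈ l) →
      ∫⁻ p, ENNReal.ofReal (phi isK ε (Function.update P a p) a o l) ∂(mu isK K a) ≤ A := by
  obtain ⟨A1, hA1, h1⟩ := free_bound
  obtain ⟨A2, hA2, h2⟩ := knot_bound hK
  have h3 : (∫⁻ x : E3, ENNReal.ofReal ((1 + ‖x‖) ^ (-(3 + ε)))) < ⊤ := by
    apply finite_integral_one_add_norm
    simp; exact hε
  refine ⟨ENNReal.ofReal A1 + ENNReal.ofReal A2 + 1 +
    (∫⁻ x : E3, ENNReal.ofReal ((1 + ‖x‖) ^ (-(3 + ε)))), ENNReal.add_ne_top.2 ⟨by simp, h3.ne⟩, ?_⟩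
  intro P a o l ha ho
  cases o with
  | none =>
    simp only [phi, tt, Function.update_self, mu]
    split_ifs
    · simp only [ENNReal.ofReal_one, lintegral_const, mK_univ hK, one_mul]
      exact le_add_right (le_add_left le_rfl)
    · exact le_add_left le_rfl
  | some b =>
    have hb : b ≠ a := fun h => ha (h ▸ ho b rfl)
    simp only [phi, Function.update_self, rnear_update P a b _ l ha hb,
      Function.update_of_ne hb, mu]
    split_ifs
    · refine (h2 (P b) (rnear P b l)).trans ?_
      exact le_add_right (le_add_right (le_add_left le_rfl))
    · refine (h1 (P b) (rnear P b l)).trans ?_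
      exact le_add_right (le_add_right (le_add_right le_rfl))

lemma FF_lmarginal [Fintype V] (isK : V → Prop) {K : ℝ → E3} {ε : ℝ} {A : ENNReal}
    (hA : A ≠ ⊤)
    (h : ∀ (P : V → E3) (a : V) (o : Option V) (l : List V), a ∉ l → (∀ b ∈ o, b ∈ l) →
      ∫⁻ p, ENNReal.ofReal (phi isK ε (Function.update P a p) a o l) ∂(mu isK K a) ≤ A)
    (l : List (V × Option V)) (hl : WF l) (P : V → E3) :
    lmarginal (mu isK K) (l.map Prod.fst).toFinset (fun P => ENNReal.ofReal (FF isK ε l P)) P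
      ≤ A ^ l.length := by
  induction l with
  | nil => simp [FF]
  | cons x l ih =>
    obtain ⟨a, o⟩ := x
    obtain ⟨h1, h2, h3⟩ := hl
    simp only [List.map_cons, List.toFinset_cons]
    rw [lmarginal_insert' _ (measurable_FF isK ε _).ennreal_ofReal (by simpa using h1)]
    have hle : (fun x : V → E3 => ∫⁻ p, ENNReal.ofReal
        (FF isK ε ((a, o) :: l) (Function.update x a p)) ∂(mu isK K a)) ≤
        fun x => A * ENNReal.ofReal (FF isK ε l x) := by
      intro x
      simp only [FF]
      have : ∀ p, ENNReal.ofReal (phi isK ε (Function.update x a p) a o (l.map Prod.fst) *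
          FF isK ε l (Function.update x a p)) =
          ENNReal.ofReal (phi isK ε (Function.update x a p) a o (l.map Prod.fst)) *
          ENNReal.ofReal (FF isK ε l x) := by
        intro p
        rw [FF_update isK ε x a p l h3 h1, ENNReal.ofReal_mul (phi_nonneg _ _ _ _ _ _)]
      simp only [this]
      rw [lintegral_mul_const' _ _ ENNReal.ofReal_ne_top]
      exact mul_le_mul_left (h x a o _ h1 h2) _
    refine (lmarginal_mono hle P).trans ?_
    have : lmarginal (mu isK K) (l.map Prod.fst).toFinset
        (fun x => A * ENNReal.ofReal (FF isK ε l x)) P = A * lmarginal (mu isK K)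
          (l.map Prod.fst).toFinset (fun x => ENNReal.ofReal (FF isK ε l x)) P := by
      unfold lmarginal
      exact lintegral_const_mul' _ _ hA
    rw [this, List.length_cons, pow_succ']
    exact mul_le_mul_right (ih h3) _

lemma FF_lintegral [Fintype V] (isK : V → Prop) {K : ℝ → E3} (hK : IsKnot K)
    {ε : ℝ} (hε : 0 < ε) (l : List (V × Option V)) (hl : WF l) (hall : ∀ v, v ∈ l.map Prod.fst) :
    ∫⁻ P, ENNReal.ofReal (FF isK ε l P) ∂(Measure.pi (mu isK K)) < ⊤ := by
  obtain ⟨A, hA, h⟩ := phi_int isK hK hε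
  have := FF_lmarginal isK hA h l hl 0
  rw [show (l.map Prod.fst).toFinset = Finset.univ by ext v; simp only [List.mem_toFinset, hall v, Finset.mem_univ]]
    at this
  rw [lintegral_eq_lmarginal_univ (0 : V → E3)]
  exact this.trans_lt (ENNReal.pow_lt_top hA.lt_top)

lemma pi_diag [Fintype V] (isK : V → Prop) {K : ℝ → E3} (hK : IsKnot K) (i j : V) (hij : i ≠ j) :
    Measure.pi (mu isK K) {P : V → E3 | P i = P j} = 0 := by
  have hm : MeasurableSet {P : V → E3 | P i = P j} :=
    measurableSet_eq_fun (by fun_prop) (by fun_prop)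
  rw [← lintegral_indicator_one hm, lintegral_eq_lmarginal_univ (0 : V → E3),
    lmarginal_erase' _ (measurable_one.indicator hm) (Finset.mem_univ i)]
  have : (fun x : V → E3 => ∫⁻ p, ({P : V → E3 | P i = P j}.indicator 1
      (Function.update x i p) : ENNReal) ∂(mu isK K i)) = fun _ => 0 := by
    ext x
    have : ∀ p, ({P : V → E3 | P i = P j}.indicator 1
      (Function.update x i p) : ENNReal) = ({x j} : Set E3).indicator 1 p := by
      intro p
      simp [Set.indicator, Function.update_of_ne hij.symm]
    simp only [this]
    rw [lintegral_indicator_one (measurableSet_singleton _)]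
    unfold mu
    split_ifs
    · exact mK_singleton hK _
    · simp
  rw [this]
  simp [lmarginal]

lemma pi_ae_inj [Fintype V] (isK : V → Prop) {K : ℝ → E3} (hK : IsKnot K) :
    ∀ᵐ P ∂(Measure.pi (mu isK K)), Function.Injective P := by
  have : ∀ᵐ P ∂(Measure.pi (mu isK K)), ∀ i j : V, i ≠ j → P i ≠ P j := by
    rw [ae_all_iff]; intro i
    rw [ae_all_iff]; intro j
    by_cases h : i = j
    · simp [h]
    · have := pi_diag isK hK i j h
      rw [ae_iff]
      simpa [h] using this
  filter_upwards [this] with P hP i j hij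
  by_contra h
  exact hP i j h hij

end CSI

namespace CSI

open MeasureTheory

variable {n : ℕ}

noncomputable def nuD (D : Diagram n) : Measure D.Config :=
  (Measure.pi (fun _ : D.IntV => volume.restrict (Set.Ioo (0:ℝ) 1))).prod
    (Measure.pi (fun _ : D.FreeV => (volume : Measure E3)))

lemma vol_le (D : Diagram n) (K : ℝ → E3) :
    (volume : Measure D.Config).restrict (D.csDomain K) ≤ nuD D := by
  have h : nuD D = (volume : Measure D.Config).restrict
      ((Set.univ.pi fun _ : D.IntV => Set.Ioo (0:ℝ) 1) ×ˢ Set.univ) := by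
    unfold nuD
    rw [← Measure.restrict_pi_pi]
    have : (Measure.pi (fun _ : D.FreeV => (volume : Measure E3))) =
      (Measure.pi (fun _ : D.FreeV => (volume : Measure E3))).restrict Set.univ := by simp
    rw [this, Measure.prod_restrict]
    rfl
  rw [h]
  apply Measure.restrict_mono _ le_rfl
  rintro z ⟨hz, -, -⟩
  refine ⟨?_, trivial⟩
  rintro ⟨v, i, rfl⟩ -
  exact hz i

lemma measurable_pt (D : Diagram n) {K : ℝ → E3} (hK : Continuous K) (v : Fin (2 * n)) :
    Measurable fun z : D.Config => D.pt K z v := by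
  unfold Diagram.pt
  split_ifs
  · have := hK.measurable
    fun_prop
  · fun_prop

lemma map_pt (D : Diagram n) {K : ℝ → E3} (hK : Continuous K) :
    Measure.map (fun z : D.Config => fun v => D.pt K z v) (nuD D) =
      Measure.pi (mu D.IsIntervalVertex K) := by
  symm
  apply Measure.pi_eq
  intro s hs
  rw [Measure.map_apply (measurable_pi_lambda _ fun v => measurable_pt D hK v)
    (MeasurableSet.univ_pi hs)]
  have : (fun z : D.Config => fun v => D.pt K z v) ⁻¹' (Set.univ.pi s) =
      (Set.univ.pi fun v : D.IntV => K ⁻¹' (s v)) ×ˢ (Set.univ.pi fun v : D.FreeV => s v) := by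
    ext z
    simp only [Set.mem_preimage, Set.mem_pi, Set.mem_univ, true_implies, Set.mem_prod]
    constructor
    · intro h
      refine ⟨fun v => ?_, fun v => ?_⟩
      · have := h v
        simpa [Diagram.pt, v.2] using this
      · have := h v
        simpa [Diagram.pt, v.2] using this
    · rintro ⟨h1, h2⟩ v
      by_cases hv : D.IsIntervalVertex v
      · simpa [Diagram.pt, hv] using h1 ⟨v, hv⟩
      · simpa [Diagram.pt, hv] using h2 ⟨v, hv⟩
  rw [this, nuD, Measure.prod_prod, Measure.pi_pi, Measure.pi_pi,
    ← Fintype.prod_subtype_mul_prod_subtype D.IsIntervalVertex]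
  congr 1
  · apply Finset.prod_congr rfl
    intro v _
    rw [mu, if_pos v.2, mK, Measure.map_apply hK.measurable (hs v)]
  · apply Finset.prod_congr rfl
    intro v _
    rw [mu, if_neg v.2]

lemma measurable_det3 {α : Type*} [MeasurableSpace α] {u v w : α → E3} (hu : Measurable u)
    (hv : Measurable v) (hw : Measurable w) : Measurable fun x => det3 (u x) (v x) (w x) := by
  unfold det3
  fun_prop

lemma measurable_csIntegrand (D : Diagram n) {K : ℝ → E3} (hK : Continuous K)
    (L : List (Sym2 (Fin (2 * n)))) (ord : Fin (2 * L.length) ≃ D.BasisIndex) :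
    Measurable (D.csIntegrand K L ord) := by
  unfold Diagram.csIntegrand wedgeEval
  refine Measurable.div_const ?_ _
  refine Finset.measurable_sum _ fun σ _ => Measurable.const_mul ?_ _
  refine Finset.measurable_prod _ fun t _ => ?_
  unfold Diagram.edgeForm sphereForm
  refine Measurable.div_const ?_ _
  refine measurable_det3 ?_ (measurable_fderiv_apply_const ℝ _ _)
    (measurable_fderiv_apply_const ℝ _ _)
  unfold Diagram.edgeDir
  have h1 := measurable_pt D hK (emax (L.get t))
  have h2 := measurable_pt D hK (emin (L.get t))
  exact (h1.sub h2).norm.inv.smul (h1.sub h2)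

lemma schemes_finite (m : ℕ) (V : Type) [Finite V] :
    {l : List (V × Option V) | WF l ∧ l.length = m ∧ ∀ v, v ∈ l.map Prod.fst}.Finite :=
  (List.finite_length_eq (V × Option V) m).subset fun _ h => h.2.1

lemma measurableSet_csDomain (D : Diagram n) {K : ℝ → E3} (hK : Continuous K) :
    MeasurableSet (D.csDomain K) := by
  unfold Diagram.csDomain
  simp only [Set.ofPred_and, Set.ofPred_forall]
  refine MeasurableSet.inter (MeasurableSet.iInter fun i => MeasurableSet.inter ?_ ?_)
    (MeasurableSet.inter (MeasurableSet.iInter fun i => MeasurableSet.iInter fun j =>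
      MeasurableSet.iInter fun _ => ?_) (MeasurableSet.iInter fun e => MeasurableSet.iInter fun _ =>
      MeasurableSet.iInter fun i => MeasurableSet.iInter fun j => MeasurableSet.iInter fun _ => ?_))
  · exact measurableSet_lt (by fun_prop) (by fun_prop)
  · exact measurableSet_lt (by fun_prop) (by fun_prop)
  · exact measurableSet_lt (by fun_prop) (by fun_prop)
  · exact (measurableSet_eq_fun (measurable_pt D hK i) (measurable_pt D hK j)).compl

theorem main (D : Diagram n) (hD : D.IsTrivalent)
    (K : ℝ → E3) (hK : IsKnot K)
    (L : List (Sym2 (Fin (2 * n)))) (hL : (L : Multiset (Sym2 (Fin (2 * n)))) = D.edges)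
    (ord : Fin (2 * L.length) ≃ D.BasisIndex) :
    MeasureTheory.IntegrableOn (D.csIntegrand K L ord) (D.csDomain K) := by
  have hKc := hK.smooth.continuous
  have hmeas := measurable_csIntegrand D hKc L ord
  refine ⟨hmeas.aestronglyMeasurable, ?_⟩
  by_cases hv : ∃ v0, D.IsIntervalVertex v0
  · obtain ⟨v0, hv0⟩ := hv
    obtain ⟨ε, hε, C, hC, hpt⟩ := pointwise D hD K hK L hL ord hv0
    have hfin := schemes_finite (2 * n) (Fin (2 * n))
    set T := hfin.toFinset with hT
    set G : (Fin (2 * n) → E3) → ENNReal := fun P => ENNReal.ofReal C *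
      ∑ l ∈ T, ENNReal.ofReal (FF D.IsIntervalVertex ε l P) with hG
    have hGm : Measurable G := Measurable.const_mul
      (Finset.measurable_sum _ fun l _ => (measurable_FF _ ε l).ennreal_ofReal) _
    have hmp : Measurable (fun z : D.Config => fun v => D.pt K z v) :=
      measurable_pi_lambda _ fun v => measurable_pt D hKc v
    have hinj : ∀ᵐ z ∂(volume : Measure D.Config).restrict (D.csDomain K),
        Function.Injective (D.pt K z) := by
      have h1 := pi_ae_inj D.IsIntervalVertex hK
      rw [← map_pt D hKc] at h1
      exact (ae_mono (vol_le D K)) (ae_of_ae_map hmp.aemeasurable h1)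
    have hdom : ∀ᵐ z ∂(volume : Measure D.Config).restrict (D.csDomain K),
        z ∈ D.csDomain K := ae_restrict_mem (measurableSet_csDomain D hKc)
    have hle : ∀ᵐ z ∂(volume : Measure D.Config).restrict (D.csDomain K),
        ‖D.csIntegrand K L ord z‖ₑ ≤ G (fun v => D.pt K z v) := by
      filter_upwards [hinj, hdom] with z h1 h2
      obtain ⟨l, hl1, hl2, hl3, hl4⟩ := hpt z h2 h1
      rw [Real.enorm_eq_ofReal_abs]
      refine (ENNReal.ofReal_le_ofReal hl4).trans ?_
      rw [ENNReal.ofReal_mul hC]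
      refine mul_le_mul_right ?_ _
      exact Finset.single_le_sum (f := fun l => ENNReal.ofReal
        (FF D.IsIntervalVertex ε l (fun v => D.pt K z v))) (fun _ _ => bot_le)
        (hfin.mem_toFinset.2 ⟨hl1, hl2, hl3⟩)
    refine (lintegral_mono_ae hle).trans_lt ?_
    refine (lintegral_mono' (vol_le D K) le_rfl).trans_lt ?_
    rw [← lintegral_map hGm hmp, map_pt D hKc, hG,
      lintegral_const_mul' _ _ ENNReal.ofReal_ne_top,
      lintegral_finsetSum _ fun l _ => (measurable_FF _ ε l).ennreal_ofReal]
    refine ENNReal.mul_lt_top ENNReal.ofReal_lt_top (ENNReal.sum_lt_top.2 fun l hl => ?_)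
    have := hfin.mem_toFinset.1 hl
    exact FF_lintegral D.IsIntervalVertex hK hε l this.1 this.2.2
  · push Not at hv
    by_cases hn : Nonempty (Fin (2 * n))
    · obtain ⟨v0⟩ := hn
      have hdom : ∀ᵐ z ∂(volume : Measure D.Config).restrict (D.csDomain K),
          z ∈ D.csDomain K := ae_restrict_mem (measurableSet_csDomain D hKc)
      refine HasFiniteIntegral.congr (hasFiniteIntegral_zero _ _) ?_
      filter_upwards [hdom] with z hz
      exact (integrand_zero D K hK L hL ord hv v0 z hz).symm
    · rw [not_nonempty_iff] at hn
      have : Subsingleton D.Config := inferInstance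
      have hf : IsFiniteMeasure (volume : Measure D.Config) := by
        have h1 : IsFiniteMeasure (Measure.pi (fun _ : D.IntV => (volume : Measure ℝ))) := by
          rw [Measure.pi_of_empty]; infer_instance
        have h2 : IsFiniteMeasure (Measure.pi (fun _ : D.FreeV => (volume : Measure E3))) := by
          rw [Measure.pi_of_empty]; infer_instance
        exact inferInstanceAs (IsFiniteMeasure
          ((Measure.pi (fun _ : D.IntV => (volume : Measure ℝ))).prod
            (Measure.pi (fun _ : D.FreeV => (volume : Measure E3)))))
      have hc : D.csIntegrand K L ord = fun _ => D.csIntegrand K L ord 0 := by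
        ext z; rw [Subsingleton.elim z 0]
      rw [hc]
      exact (integrable_const _).2

end CSI

/-- **Absolute convergence of the Bott–Taubes configuration space integrals**
(cf. §3.3 and §4 of the paper): for every knot `K` and every labeled degree-`n`
trivalent diagram `D`, with any ordering `L` of its edge set and any ordering `ord`
of the standard basis, the integrand of `I(D, K)` is Lebesgue integrable on the open
configuration space domain `C(D, K)`. -/
theorem cs_integral_converges (n : ℕ) (D : Diagram n) (hD : D.IsTrivalent)
    (K : ℝ → E3) (hK : IsKnot K)
    (L : List (Sym2 (Fin (2 * n)))) (hL : (L : Multiset (Sym2 (Fin (2 * n)))) = D.edges)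
    (ord : Fin (2 * L.length) ≃ D.BasisIndex) :
    MeasureTheory.IntegrableOn (D.csIntegrand K L ord) (D.csDomain K) := CSI.main D hD K hK L hL ord
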